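/- (Bonnet-type theorem, second type) Let K, ϰ : D → ℝ be smooth functions on an open set D ⊆ ℝ² with K² − ϰ² > 0 on D, satisfying the system of natural equations |K² − ϰ²|^{1/4}·Δ^h(ln|K² − ϰ²|) = −8K and |K² − ϰ²|^{1/4}·Δ^h(ln|(K + ϰ)/(K − ϰ)|) = −4ϰ. Then for every t₀ ∈ D there exist an open neighborhood D₀ ⊆ D of t₀ and a smooth minimal time-like surface x : D₀ → ℝ⁴ in canonical coordinates with parameters (ε₀,ε₁) = (−1,0) whose Gauss curvature and normal curvature coincide with the given K and ϰ on D₀. Moreover, if x̂ is another such surface defined on a neighborhood of t₀, then there exist a neighborhood D̃₀ of t₀, a linear map A : ℝ⁴ → ℝ⁴ with ⟨Av,Aw⟩ = ⟨v,w⟩ for all v,w and det A = 1, and c ∈ ℝ⁴, such that x̂ = A∘x + c on D̃₀. -/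

import Mathlib

noncomputable section

abbrev V4 : Type := Fin 4 → ℝ

/-- The indefinite scalar product of `ℝ⁴₂`. -/
def ip (a b : V4) : ℝ := -(a 0 * b 0) + a 1 * b 1 - a 2 * b 2 + a 3 * b 3

/-- Partial derivative w.r.t. the first variable. -/
def pu {E : Type*} [NormedAddCommGroup E] [NormedSpace ℝ E]
    (f : ℝ × ℝ → E) (p : ℝ × ℝ) : E := fderiv ℝ f p (1, 0)

/-- Partial derivative w.r.t. the second variable. -/
def pv {E : Type*} [NormedAddCommGroup E] [NormedSpace ℝ E]
    (f : ℝ × ℝ → E) (p : ℝ × ℝ) : E := fderiv ℝ f p (0, 1)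

/-- `E`, the first coefficient of the first fundamental form. -/
def Ef (x : ℝ × ℝ → V4) (p : ℝ × ℝ) : ℝ := ip (pu x p) (pu x p)

/-- Normal projection of a vector `w` at the point `p` of the surface `x`:
`w^⊥ = w − (⟨w,x_u⟩/E)·x_u + (⟨w,x_v⟩/E)·x_v`. -/
def nproj (x : ℝ × ℝ → V4) (w : V4) (p : ℝ × ℝ) : V4 :=
  w - (ip w (pu x p) / Ef x p) • pu x p + (ip w (pv x p) / Ef x p) • pv x p

/-- `a = (x_uu)^⊥`. -/
def sffA (x : ℝ × ℝ → V4) (p : ℝ × ℝ) : V4 := nproj x (pu (pu x) p) p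

/-- `b = (x_uv)^⊥`. -/
def sffB (x : ℝ × ℝ → V4) (p : ℝ × ℝ) : V4 := nproj x (pv (pu x) p) p

/-- Determinant of the 4×4 matrix with columns `v1, v2, v3, v4`. -/
def det4 (v1 v2 v3 v4 : V4) : ℝ := (Matrix.of ![v1, v2, v3, v4]).transpose.det

/-- The Gauss curvature `K = (⟨b,b⟩ − ⟨a,a⟩)/E²`. -/
def GaussK (x : ℝ × ℝ → V4) (p : ℝ × ℝ) : ℝ :=
  (ip (sffB x p) (sffB x p) - ip (sffA x p) (sffA x p)) / (Ef x p) ^ 2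

/-- The curvature of the normal connection `ϰ = −2·det[x_u,x_v,a,b]/E³`. -/
def NormK (x : ℝ × ℝ → V4) (p : ℝ × ℝ) : ℝ :=
  -2 * det4 (pu x p) (pv x p) (sffA x p) (sffB x p) / (Ef x p) ^ 3

/-- The hyperbolic Laplacian `Δʰ f = f_uu − f_vv`. -/
def hlap (f : ℝ × ℝ → ℝ) (p : ℝ × ℝ) : ℝ := pu (pu f) p - pv (pv f) p

/-- Time-like surface in isothermal coordinates with `E < 0`. -/
def IsTimelikeIso (D : Set (ℝ × ℝ)) (x : ℝ × ℝ → V4) : Prop :=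
  ∀ p ∈ D, Ef x p < 0 ∧ ip (pv x p) (pv x p) = -(Ef x p) ∧ ip (pu x p) (pv x p) = 0

/-- Minimality: `x_uu − x_vv = 0`. -/
def IsMinimal (D : Set (ℝ × ℝ)) (x : ℝ × ℝ → V4) : Prop :=
  ∀ p ∈ D, pu (pu x) p - pv (pv x) p = 0

/-- Degenerate point: `(⟨a,a⟩+⟨b,b⟩)² = 4⟨a,b⟩²`. -/
def DegeneratePt (x : ℝ × ℝ → V4) (p : ℝ × ℝ) : Prop :=
  (ip (sffA x p) (sffA x p) + ip (sffB x p) (sffB x p)) ^ 2 =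
    4 * (ip (sffA x p) (sffB x p)) ^ 2

/-- Surface of the first type. -/
def FirstType (D : Set (ℝ × ℝ)) (x : ℝ × ℝ → V4) : Prop :=
  ∀ p ∈ D,
    (ip (sffA x p) (sffA x p) + ip (sffB x p) (sffB x p)) ^ 2 -
      4 * (ip (sffA x p) (sffB x p)) ^ 2 > 0 ∧
    ip (sffA x p) (sffA x p) + ip (sffB x p) (sffB x p) > 0

/-- Surface of the second type. -/
def SecondType (D : Set (ℝ × ℝ)) (x : ℝ × ℝ → V4) : Prop :=
  ∀ p ∈ D,
    (ip (sffA x p) (sffA x p) + ip (sffB x p) (sffB x p)) ^ 2 -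
      4 * (ip (sffA x p) (sffB x p)) ^ 2 > 0 ∧
    ip (sffA x p) (sffA x p) + ip (sffB x p) (sffB x p) < 0

/-- Surface of the third type. -/
def ThirdType (D : Set (ℝ × ℝ)) (x : ℝ × ℝ → V4) : Prop :=
  ∀ p ∈ D,
    (ip (sffA x p) (sffA x p) + ip (sffB x p) (sffB x p)) ^ 2 -
      4 * (ip (sffA x p) (sffB x p)) ^ 2 < 0

/-- Canonical coordinates with parameters `(e0, e1)`:
`⟨a,a⟩+⟨b,b⟩ = e0` and `2⟨a,b⟩ = e1` identically. -/
def Canonical (D : Set (ℝ × ℝ)) (x : ℝ × ℝ → V4) (e0 e1 : ℝ) : Prop :=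
  ∀ p ∈ D,
    ip (sffA x p) (sffA x p) + ip (sffB x p) (sffB x p) = e0 ∧
    2 * ip (sffA x p) (sffB x p) = e1

/-- A minimal time-like surface in canonical coordinates with parameters (-1, 0). -/
def GoodSurf (D₀ : Set (ℝ × ℝ)) (x : ℝ × ℝ → V4) : Prop :=
  ContDiffOn ℝ (⊤ : ℕ∞) x D₀ ∧ IsTimelikeIso D₀ x ∧ IsMinimal D₀ x ∧
    Canonical D₀ x (-1) (0)

/-- The null coordinate `u + v` centred at `o`. -/
def nullS (o p : ℝ × ℝ) : ℝ := (p.1 - o.1) + (p.2 - o.2)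

/-- The null coordinate `u - v` centred at `o`. -/
def nullT (o p : ℝ × ℝ) : ℝ := (p.1 - o.1) - (p.2 - o.2)

/-- The point with null coordinates `(s, t)` centred at `o`. -/
def nullPt (o : ℝ × ℝ) (s t : ℝ) : ℝ × ℝ := (o.1 + (s + t) / 2, o.2 + (s - t) / 2)

/-- The null square of size `r` centred at `o`. -/
def nullSq (o : ℝ × ℝ) (r : ℝ) : Set (ℝ × ℝ) := {p | |nullS o p| < r ∧ |nullT o p| < r}

theorem nullS_nullPt (o : ℝ × ℝ) (s t : ℝ) : nullS o (nullPt o s t) = s := by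
  simp only [nullS, nullPt]; ring

theorem nullT_nullPt (o : ℝ × ℝ) (s t : ℝ) : nullT o (nullPt o s t) = t := by
  simp only [nullT, nullPt]; ring

theorem nullPt_null (o p : ℝ × ℝ) : nullPt o (nullS o p) (nullT o p) = p := by
  ext <;> simp only [nullT, nullS, nullPt] <;> ring

theorem nullPt_mem {o : ℝ × ℝ} {r s t : ℝ} (hs : |s| < r) (ht : |t| < r) :
    nullPt o s t ∈ nullSq o r :=
  ⟨by rwa [nullS_nullPt], by rwa [nullT_nullPt]⟩

theorem self_mem_nullSq (o : ℝ × ℝ) {r : ℝ} (hr : 0 < r) : o ∈ nullSq o r := by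
  simp [nullSq, nullS, nullT, hr]

theorem isOpen_nullSq (o : ℝ × ℝ) (r : ℝ) : IsOpen (nullSq o r) := by
  have h1 : Continuous (fun p => |nullS o p|) := by unfold nullS; fun_prop
  have h2 : Continuous (fun p => |nullT o p|) := by unfold nullT; fun_prop
  exact (isOpen_lt h1 continuous_const).inter (isOpen_lt h2 continuous_const)

theorem exists_nullSq_subset {o : ℝ × ℝ} {U : Set (ℝ × ℝ)} (hU : IsOpen U) (ho : o ∈ U) :
    ∃ r > 0, nullSq o r ⊆ U := by
  obtain ⟨r, hr, h⟩ := Metric.isOpen_iff.1 hU o ho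
  refine ⟨r, hr, fun p hp => h ?_⟩
  obtain ⟨h1, h2⟩ := hp
  rw [abs_lt] at h1 h2
  simp only [nullS, nullT] at h1 h2
  rw [Metric.mem_ball, Prod.dist_eq, max_lt_iff, Real.dist_eq, Real.dist_eq, abs_lt, abs_lt]
  exact ⟨⟨by linarith, by linarith⟩, ⟨by linarith, by linarith⟩⟩

section Splitting

variable {E : Type*} [NormedAddCommGroup E] [NormedSpace ℝ E]

theorem pu_pv_of_split {o : ℝ × ℝ} {r : ℝ} {f : ℝ × ℝ → E} {α β A B : ℝ → E}
    (hα : ∀ s, |s| < r → HasDerivAt α (A s) s) (hβ : ∀ t, |t| < r → HasDerivAt β (B t) t)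
    (hf : ∀ p ∈ nullSq o r, f p = α (nullS o p) + β (nullT o p)) {p : ℝ × ℝ}
    (hp : p ∈ nullSq o r) :
    pu f p = A (nullS o p) + B (nullT o p) ∧ pv f p = A (nullS o p) - B (nullT o p) := by
  have hS : HasFDerivAt (nullS o)
      (ContinuousLinearMap.fst ℝ ℝ ℝ + ContinuousLinearMap.snd ℝ ℝ ℝ) p :=
    (hasFDerivAt_fst.sub_const _).add (hasFDerivAt_snd.sub_const _)
  have hT : HasFDerivAt (nullT o)
      (ContinuousLinearMap.fst ℝ ℝ ℝ - ContinuousLinearMap.snd ℝ ℝ ℝ) p :=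
    (hasFDerivAt_fst.sub_const _).sub (hasFDerivAt_snd.sub_const _)
  have h := ((hα _ hp.1).hasFDerivAt.comp p hS).add ((hβ _ hp.2).hasFDerivAt.comp p hT)
  have h' : f =ᶠ[nhds p] (α ∘ nullS o) + (β ∘ nullT o) := by
    filter_upwards [(isOpen_nullSq o r).mem_nhds hp] with q hq using hf q hq
  have h2 := (h.congr_of_eventuallyEq h').fderiv
  simp [pu, pv, h2, sub_eq_add_neg]

/-- `x` is, on a null square, a sum of two curves depending on one null coordinate each; the
curves are twice differentiable. -/
structure NullSplit (o : ℝ × ℝ) (r : ℝ) (x : ℝ × ℝ → E) (α β A B A' B' : ℝ → E) : Prop where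
  eq : ∀ p ∈ nullSq o r, x p = α (nullS o p) + β (nullT o p)
  dα : ∀ s, |s| < r → HasDerivAt α (A s) s
  dβ : ∀ t, |t| < r → HasDerivAt β (B t) t
  dA : ∀ s, |s| < r → HasDerivAt A (A' s) s
  dB : ∀ t, |t| < r → HasDerivAt B (B' t) t

namespace NullSplit

variable {o : ℝ × ℝ} {r : ℝ} {x : ℝ × ℝ → E} {α β A B A' B' : ℝ → E}

theorem pu_eq (h : NullSplit o r x α β A B A' B') {p : ℝ × ℝ} (hp : p ∈ nullSq o r) :
    pu x p = A (nullS o p) + B (nullT o p) :=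
  (pu_pv_of_split h.dα h.dβ h.eq hp).1

theorem pv_eq (h : NullSplit o r x α β A B A' B') {p : ℝ × ℝ} (hp : p ∈ nullSq o r) :
    pv x p = A (nullS o p) - B (nullT o p) :=
  (pu_pv_of_split h.dα h.dβ h.eq hp).2

theorem pu_pu_eq (h : NullSplit o r x α β A B A' B') {p : ℝ × ℝ} (hp : p ∈ nullSq o r) :
    pu (pu x) p = A' (nullS o p) + B' (nullT o p) :=
  (pu_pv_of_split h.dA h.dB (fun _ hq => h.pu_eq hq) hp).1

theorem pv_pu_eq (h : NullSplit o r x α β A B A' B') {p : ℝ × ℝ} (hp : p ∈ nullSq o r) :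
    pv (pu x) p = A' (nullS o p) - B' (nullT o p) :=
  (pu_pv_of_split h.dA h.dB (fun _ hq => h.pu_eq hq) hp).2

theorem pv_pv_eq (h : NullSplit o r x α β A B A' B') {p : ℝ × ℝ} (hp : p ∈ nullSq o r) :
    pv (pv x) p = A' (nullS o p) + B' (nullT o p) := by
  have := (pu_pv_of_split (B := fun t => - B' t) h.dA (fun t ht => (h.dB t ht).neg)
    (fun _ hq => (h.pv_eq hq).trans (sub_eq_add_neg _ _)) hp).2
  simpa using this

end NullSplit

end Splitting

theorem det4_eq (a b c d : V4) : det4 a b c d =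
    a 0 * (b 1 * (c 2 * d 3 - c 3 * d 2) - b 2 * (c 1 * d 3 - c 3 * d 1)
      + b 3 * (c 1 * d 2 - c 2 * d 1))
    - a 1 * (b 0 * (c 2 * d 3 - c 3 * d 2) - b 2 * (c 0 * d 3 - c 3 * d 0)
      + b 3 * (c 0 * d 2 - c 2 * d 0))
    + a 2 * (b 0 * (c 1 * d 3 - c 3 * d 1) - b 1 * (c 0 * d 3 - c 3 * d 0)
      + b 3 * (c 0 * d 1 - c 1 * d 0))
    - a 3 * (b 0 * (c 1 * d 2 - c 2 * d 1) - b 1 * (c 0 * d 2 - c 2 * d 0)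
      + b 2 * (c 0 * d 1 - c 1 * d 0)) := by
  unfold det4
  rw [Matrix.det_transpose, Matrix.det_succ_row_zero]
  simp [Fin.sum_univ_succ, Matrix.det_fin_three, Fin.succAbove]
  ring

theorem ip_comm (a b : V4) : ip a b = ip b a := by
  simp only [ip]; ring

theorem ip_add_left (a b c : V4) : ip (a + b) c = ip a c + ip b c := by
  simp only [ip, Pi.add_apply]; ring

theorem ip_sub_left (a b c : V4) : ip (a - b) c = ip a c - ip b c := by
  simp only [ip, Pi.sub_apply]; ring

theorem ip_smul_left (k : ℝ) (a b : V4) : ip (k • a) b = k * ip a b := by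
  simp only [ip, Pi.smul_apply, smul_eq_mul]; ring

theorem ip_add_right (a b c : V4) : ip a (b + c) = ip a b + ip a c := by
  simp only [ip, Pi.add_apply]; ring

theorem ip_sub_right (a b c : V4) : ip a (b - c) = ip a b - ip a c := by
  simp only [ip, Pi.sub_apply]; ring

theorem ip_smul_right (k : ℝ) (a b : V4) : ip a (k • b) = k * ip a b := by
  simp only [ip, Pi.smul_apply, smul_eq_mul]; ring

/-- The square of a determinant is the Gram determinant; here the first two vectors are null and
orthogonal to the third and to the fourth respectively. -/
theorem det4_sq {A B A' B' : V4} (hA : ip A A = 0) (hB : ip B B = 0) (hAA' : ip A A' = 0)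
    (hBB' : ip B B' = 0) :
    det4 A B A' B' ^ 2 = (ip A B * ip A' B' - ip A' B * ip A B') ^ 2
      - ip A B ^ 2 * (ip A' A' * ip B' B') := by
  set F : Matrix (Fin 4) (Fin 4) ℝ := Matrix.of ![A, B, A', B'] with hF
  set J : Matrix (Fin 4) (Fin 4) ℝ := Matrix.diagonal ![-1, 1, -1, 1] with hJ
  have hG : F * J * F.transpose = Matrix.of ![![0, ip A B, 0, ip A B'], ![ip A B, 0, ip A' B, 0],
      ![0, ip A' B, ip A' A', ip A' B'], ![ip A B', 0, ip A' B', ip B' B']] := by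
    have key : F * J * F.transpose = Matrix.of fun i j => ip (F i) (F j) := by
      ext i j
      simp [hJ, Matrix.mul_apply, Fin.sum_univ_four, Matrix.diagonal_apply, ip]
      ring
    rw [key]
    ext i j
    fin_cases i <;> fin_cases j
    exacts [hA, rfl, hAA', rfl, ip_comm B A, hB, ip_comm B A', hBB', (ip_comm A' A).trans hAA', rfl,
      rfl, rfl, ip_comm B' A, (ip_comm B' B).trans hBB', ip_comm B' A', rfl]
  have hd : F.det = det4 A B A' B' := by rw [det4, Matrix.det_transpose]
  have hJd : J.det = 1 := by simp [hJ, Matrix.det_diagonal, Fin.prod_univ_four]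
  have h := congrArg Matrix.det hG
  rw [Matrix.det_mul, Matrix.det_mul, Matrix.det_transpose, hd, hJd] at h
  rw [mul_one, ← sq] at h
  rw [h]
  rw [Matrix.det_succ_row_zero]
  simp [Fin.sum_univ_succ, Matrix.det_fin_three, Fin.succAbove]
  ring

theorem det4_add_sub (A B C D : V4) : det4 (A + B) (A - B) (C + D) (C - D) = 4 * det4 A B C D := by
  simp only [det4_eq, Pi.add_apply, Pi.sub_apply]; ring

theorem det4_sub_smul (A B C D : V4) (k l : ℝ) :
    det4 A B (C - k • A) (D - l • B) = det4 A B C D := by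
  simp only [det4_eq, Pi.sub_apply, Pi.smul_apply, smul_eq_mul]; ring

/-- The second fundamental form at a point where the derivatives of the surface are given by
the null vectors `A`, `B` and their derivatives. -/
theorem nproj_null {x : ℝ × ℝ → V4} {p : ℝ × ℝ} {A B : V4} (hu : pu x p = A + B)
    (hv : pv x p = A - B) (hA : ip A A = 0) (hB : ip B B = 0) (hN : ip A B ≠ 0) {w z : V4}
    (hw : ip A w = 0) (hz : ip B z = 0) :
    nproj x (w + z) p = (w - (ip w B / ip A B) • A) + (z - (ip A z / ip A B) • B) ∧
    nproj x (w - z) p = (w - (ip w B / ip A B) • A) - (z - (ip A z / ip A B) • B) := by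
  have hE : Ef x p = 2 * ip A B := by
    rw [Ef, hu, ip_add_left, ip_add_right, ip_add_right, hA, hB, ip_comm B A]; ring
  rw [ip_comm] at hw hz
  constructor
  all_goals
    rw [nproj, hu, hv, hE]
    simp only [ip_add_left, ip_add_right, ip_sub_left, ip_sub_right, hw, hz, ip_comm z A]
    ext i
    simp only [Pi.add_apply, Pi.sub_apply, Pi.smul_apply, smul_eq_mul]
    field_simp
    ring

/-- The invariants of a surface at a point, expressed through null data. -/
theorem invariants_null {x : ℝ × ℝ → V4} {p : ℝ × ℝ} {A B A' B' : V4} (hu : pu x p = A + B)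
    (hv : pv x p = A - B) (huu : pu (pu x) p = A' + B') (huv : pv (pu x) p = A' - B')
    (hA : ip A A = 0) (hB : ip B B = 0) (hN : ip A B ≠ 0)
    (hA' : ip A A' = 0) (hB' : ip B B' = 0) :
    ip (sffA x p) (sffA x p) + ip (sffB x p) (sffB x p) = 2 * (ip A' A' + ip B' B') ∧
    2 * ip (sffA x p) (sffB x p) = 2 * (ip A' A' - ip B' B') ∧
    GaussK x p = -(ip A B * ip A' B' - ip A' B * ip A B') / ip A B ^ 3 ∧
    NormK x p = - det4 A B A' B' / ip A B ^ 3 := by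
  have hE : Ef x p = 2 * ip A B := by
    rw [Ef, hu, ip_add_left, ip_add_right, ip_add_right, hA, hB, ip_comm B A]; ring
  obtain ⟨h1, h2⟩ := nproj_null hu hv hA hB hN hA' hB'
  have hCC : ip (A' - (ip A' B / ip A B) • A) (A' - (ip A' B / ip A B) • A) = ip A' A' := by
    simp only [ip_sub_left, ip_sub_right, ip_smul_left, ip_smul_right, hA, hA', ip_comm A' A]
    ring
  have hDD : ip (B' - (ip A B' / ip A B) • B) (B' - (ip A B' / ip A B) • B) = ip B' B' := by
    simp only [ip_sub_left, ip_sub_right, ip_smul_left, ip_smul_right, hB, hB', ip_comm B' B]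
    ring
  have hCD : ip (A' - (ip A' B / ip A B) • A) (B' - (ip A B' / ip A B) • B) =
      (ip A B * ip A' B' - ip A' B * ip A B') / ip A B := by
    simp only [ip_sub_left, ip_sub_right, ip_smul_left, ip_smul_right]
    field_simp
    ring
  have hdet := det4_sub_smul A B A' B' (ip A' B / ip A B) (ip A B' / ip A B)
  rw [← huu] at h1
  rw [← huv] at h2
  set C := A' - (ip A' B / ip A B) • A
  set D := B' - (ip A B' / ip A B) • B
  refine ⟨?_, ?_, ?_, ?_⟩
  · rw [sffA, sffB, h1, h2]
    simp only [ip_add_left, ip_add_right, ip_sub_left, ip_sub_right, ip_comm D C, hCC, hDD]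
    ring
  · rw [sffA, sffB, h1, h2]
    simp only [ip_add_left, ip_sub_right, ip_comm D C, hCC, hDD]
    ring
  · rw [GaussK, hE, sffA, sffB, h1, h2]
    simp only [ip_add_left, ip_add_right, ip_sub_left, ip_sub_right, ip_comm D C, hCC, hDD, hCD]
    field_simp
    ring
  · rw [NormK, hE, sffA, sffB, h1, h2, hu, hv, det4_add_sub, hdet]
    field_simp
    ring

theorem eq_zero_value_of_hasDerivAt_zero {E : Type*} [NormedAddCommGroup E] [NormedSpace ℝ E]
    {r : ℝ} {f : ℝ → E} (h : ∀ s, |s| < r → HasDerivAt f 0 s) {s : ℝ} (hs : |s| < r) :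
    f s = f 0 := by
  have hr : 0 < r := (abs_nonneg s).trans_lt hs
  have key : ∀ y, y ∈ Set.Ioo (-r) r → |y| < r := fun y hy => abs_lt.2 hy
  exact isOpen_Ioo.is_const_of_deriv_eq_zero (convex_Ioo (-r) r).isPreconnected
    (fun y hy => (h y (key y hy)).differentiableAt.differentiableWithinAt)
    (fun y hy => (h y (key y hy)).deriv) (abs_lt.1 hs) ⟨by linarith, hr⟩

/-- The vector dual to `det4 a b c ·` with respect to `ip`. -/
def cross (a b c : V4) : V4 :=
  ![-det4 a b c (Pi.single 0 1), det4 a b c (Pi.single 1 1),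
    -det4 a b c (Pi.single 2 1), det4 a b c (Pi.single 3 1)]

theorem ip_cross (a b c w : V4) : ip (cross a b c) w = det4 a b c w := by
  simp [cross, ip, det4_eq]
  ring

theorem det4_cross {a b c : V4} (ha : ip a a = 0) (hb : ip b b = 0) (hbc : ip b c = 0) :
    det4 a b c (cross a b c) = - ip a b ^ 2 * ip c c := by
  have key : det4 a b c (cross a b c) = ip a a * (ip b b * ip c c - ip b c ^ 2)
      - ip a b * (ip a b * ip c c - ip b c * ip a c) + ip a c * (ip a b * ip b c
        - ip b b * ip a c) := by
    simp [cross, ip, det4_eq]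
    ring
  rw [key, ha, hb, hbc]; ring

theorem det4_identity (a b v w c : V4) (hb : ip b b = 0) (hbc : ip b c = 0) :
    ip v b * det4 a b w c - ip w b * det4 a b v c = ip a b * det4 v b w c := by
  have key : ip v b * det4 a b w c - ip w b * det4 a b v c - ip a b * det4 v b w c =
      - ip b b * det4 v w c a - ip b c * det4 v b w a := by
    simp only [ip, det4_eq]
    ring
  rw [hb, hbc] at key
  linarith

theorem det4_swap_last (a b c d : V4) : det4 a b d c = - det4 a b c d := by
  simp only [det4_eq]; ring

theorem det4_swap_pairs (a b c d : V4) : det4 b a d c = det4 a b c d := by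
  simp only [det4_eq]; ring

theorem eq_zero_of_orthogonal {a b c w : V4} (ha : ip a a = 0) (hb : ip b b = 0)
    (hbc : ip b c = 0) (hab : ip a b ≠ 0) (hc : ip c c ≠ 0) (h1 : ip a w = 0) (h2 : ip b w = 0)
    (h3 : ip c w = 0) (h4 : det4 a b c w = 0) : w = 0 := by
  set F : Matrix (Fin 4) (Fin 4) ℝ := Matrix.of ![a, b, c, cross a b c] with hF
  set J : Matrix (Fin 4) (Fin 4) ℝ := Matrix.diagonal ![-1, 1, -1, 1] with hJ
  have hd : (F * J).det ≠ 0 := by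
    have hJd : J.det = 1 := by simp [hJ, Matrix.det_diagonal, Fin.prod_univ_four]
    have hd : F.det = det4 a b c (cross a b c) := by rw [det4, Matrix.det_transpose]
    rw [Matrix.det_mul, hJd, hd, det4_cross ha hb hbc, mul_one]
    exact mul_ne_zero (neg_ne_zero.2 (pow_ne_zero _ hab)) hc
  refine Matrix.eq_zero_of_mulVec_eq_zero hd ?_
  rw [← ip_cross] at h4
  have key : ∀ i, (F * J).mulVec w i = ip (F i) w := by
    intro i
    simp [hJ, Matrix.mulVec, dotProduct, Fin.sum_univ_four, ip]
    ring
  ext i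
  rw [key]
  fin_cases i
  exacts [h1, h2, h3, h4]

/-- A null curve is determined by its initial point, two of its coordinate functions, and a
Wronskian-type determinant. -/
theorem null_curve_unique {r : ℝ} {A C A' C' : ℝ → V4} {b b' : V4}
    (hA : ∀ s, |s| < r → HasDerivAt A (A' s) s) (hC : ∀ s, |s| < r → HasDerivAt C (C' s) s)
    (hA0 : ∀ s, |s| < r → ip (A s) (A s) = 0) (hC0 : ∀ s, |s| < r → ip (C s) (C s) = 0)
    (hb : ip b b = 0) (hbb' : ip b b' = 0) (hb' : ip b' b' ≠ 0) (h0 : A 0 = C 0)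
    (hne : ∀ s, |s| < r → ip (A s) b ≠ 0)
    (h1 : ∀ s, |s| < r → ip (A s) b = ip (C s) b)
    (h2 : ∀ s, |s| < r → ip (A s) b' = ip (C s) b')
    (h3 : ∀ s, |s| < r → det4 (A s) b (A' s) b' = det4 (C s) b (C' s) b')
    {s : ℝ} (hs : |s| < r) : A s = C s := by
  have hr : |(0 : ℝ)| < r := by simpa using (abs_nonneg s).trans_lt hs
  have dip : ∀ (w : V4) (X : ℝ → V4) (X' : V4) (s : ℝ), HasDerivAt X X' s →
      HasDerivAt (fun s => ip (X s) w) (ip X' w) s := by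
    intro w X X' s h
    have h := hasDerivAt_pi.1 h
    exact ((((h 0).mul_const _).neg.add ((h 1).mul_const _)).sub ((h 2).mul_const _)).add
      ((h 3).mul_const _)
  have ddet : ∀ (X : ℝ → V4) (X' : V4) (s : ℝ), HasDerivAt X X' s →
      HasDerivAt (fun s => det4 (A 0) b (X s) b') (det4 (A 0) b X' b') s := by
    intro X X' s h
    have e : ∀ w, det4 (A 0) b w b' = ip w (-cross (A 0) b b') := by
      intro w
      rw [det4_swap_last, ← ip_cross, ip_comm]
      simp only [ip, Pi.neg_apply]; ring
    simp only [e]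
    exact dip _ _ _ _ h
  have hz : det4 (A 0) b (A s) b' = det4 (A 0) b (C s) b' := by
    have hconst := eq_zero_value_of_hasDerivAt_zero (r := r)
      (f := fun s => (det4 (A 0) b (A s) b' - det4 (A 0) b (C s) b') / ip (A s) b) ?_ hs
    · simp only [← h0, sub_self, zero_div] at hconst
      rcases div_eq_zero_iff.1 hconst with h | h
      · linarith
      · exact absurd h (hne s hs)
    · intro t ht
      have h := ((ddet A _ t (hA t ht)).sub (ddet C _ t (hC t ht))).div
        (dip b A _ t (hA t ht)) (hne t ht)
      refine h.congr_deriv ?_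
      have hd : ip (A' t) b = ip (C' t) b := by
        refine (dip b A _ t (hA t ht)).unique ((dip b C _ t (hC t ht)).congr_of_eventuallyEq ?_)
        filter_upwards [(isOpen_lt continuous_abs continuous_const).mem_nhds ht] with q hq
          using h1 q hq
      have e1 := det4_identity (A 0) b (A t) (A' t) b' hb hbb'
      have e2 := det4_identity (A 0) b (C t) (C' t) b' hb hbb'
      rw [← h3 t ht, ← h1 t ht, ← hd] at e2
      rw [div_eq_zero_iff]
      left
      simp only [Pi.sub_apply]
      linarith
  have hN := hne 0 hr
  set k := ip (A s - C s) (A 0) / ip (A 0) b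
  have hw : A s - C s - k • b = 0 := by
    refine eq_zero_of_orthogonal (hA0 0 hr) hb hbb' hN hb' ?_ ?_ ?_ ?_
    · rw [ip_sub_right, ip_smul_right, ip_comm]
      simp only [k]; field_simp; ring
    · rw [ip_sub_right, ip_smul_right, hb, ip_sub_right, ip_comm b, ip_comm b, h1 s hs]; ring
    · rw [ip_sub_right, ip_smul_right, ip_sub_right, ip_comm b' b, hbb', ip_comm b', ip_comm b',
        h2 s hs]
      ring
    · have : det4 (A 0) b b' (A s - C s - k • b) =
          - (det4 (A 0) b (A s) b' - det4 (A 0) b (C s) b') := by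
        simp only [det4_eq, Pi.sub_apply, Pi.smul_apply, smul_eq_mul]; ring
      rw [this, hz]; ring
  have hAC : A s = C s + k • b := by rw [sub_sub, sub_eq_zero] at hw; exact hw
  have hk : k = 0 := by
    have h := hA0 s hs
    rw [hAC] at h
    simp only [ip_add_left, ip_add_right, ip_smul_left, ip_smul_right, hC0 s hs, hb,
      ip_comm b (C s)] at h
    have h' := hne s hs
    rw [h1 s hs] at h'
    have : k * ip (C s) b = 0 := by linarith
    exact (mul_eq_zero.1 this).resolve_right h'
  rw [hAC, hk, zero_smul, add_zero]

/-- Witt-type extension: two quadruples with the same Gram matrix and determinant are related by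
a proper motion. -/
theorem exists_proper_isometry {a b c d a' b' c' d' : V4} (ha : ip a a = 0) (hb : ip b b = 0)
    (hbc : ip b c = 0) (hab : ip a b ≠ 0) (hc : ip c c ≠ 0)
    (haa' : ip a a = ip a' a') (hbb' : ip b b = ip b' b') (hcc' : ip c c = ip c' c')
    (hab' : ip a b = ip a' b') (hac' : ip a c = ip a' c') (hbc' : ip b c = ip b' c')
    (had' : ip a d = ip a' d') (hbd' : ip b d = ip b' d') (hcd' : ip c d = ip c' d')
    (hdet : det4 a b c d = det4 a' b' c' d') :
    ∃ G : V4 →ₗ[ℝ] V4, (∀ v w, ip (G v) (G w) = ip v w) ∧ LinearMap.det G = 1 ∧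
      G a = a' ∧ G b = b' ∧ G c = c' ∧ G d = d' := by
  set n := cross a b c
  set n' := cross a' b' c'
  set F : Matrix (Fin 4) (Fin 4) ℝ := Matrix.of ![a, b, c, n] with hF
  set F' : Matrix (Fin 4) (Fin 4) ℝ := Matrix.of ![a', b', c', n'] with hF'
  set J : Matrix (Fin 4) (Fin 4) ℝ := Matrix.diagonal ![-1, 1, -1, 1] with hJ
  have ha' := haa' ▸ ha
  have hb' := hbb' ▸ hb
  have hbc'' := hbc' ▸ hbc
  have hd : F.det = - ip a b ^ 2 * ip c c := by
    rw [← det4_cross ha hb hbc, det4, Matrix.det_transpose]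
  have hd' : F'.det = - ip a b ^ 2 * ip c c := by
    rw [hab', hcc', ← det4_cross ha' hb' hbc'', det4, Matrix.det_transpose]
  have hne : - ip a b ^ 2 * ip c c ≠ 0 :=
    mul_ne_zero (neg_ne_zero.2 (pow_ne_zero _ hab)) hc
  have gram : ∀ M : Matrix (Fin 4) (Fin 4) ℝ,
      M * J * M.transpose = Matrix.of fun i j => ip (M i) (M j) := by
    intro M
    ext i j
    simp [hJ, Matrix.mul_apply, Fin.sum_univ_four, Matrix.diagonal_apply, ip]
    ring
  have hn : ∀ u v w : V4, ip (cross u v w) u = 0 ∧ ip (cross u v w) v = 0 ∧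
      ip (cross u v w) w = 0 := by
    intro u v w
    refine ⟨?_, ?_, ?_⟩ <;> rw [ip_cross] <;> simp only [det4_eq] <;> ring
  obtain ⟨n1, n2, n3⟩ := hn a b c
  obtain ⟨n1', n2', n3'⟩ := hn a' b' c'
  have n4 : ip n n = ip n' n' := by
    rw [ip_cross, ip_cross, det4_cross ha hb hbc, det4_cross ha' hb' hbc'', hab', hcc']
  have hgram : F * J * F.transpose = F' * J * F'.transpose := by
    rw [gram, gram]
    ext i j
    fin_cases i <;> fin_cases j
    exacts [haa', hab', hac', (ip_comm _ _).trans (n1.trans (n1'.symm.trans (ip_comm _ _))),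
      (ip_comm _ _).trans (hab'.trans (ip_comm _ _)), hbb', hbc',
      (ip_comm _ _).trans (n2.trans (n2'.symm.trans (ip_comm _ _))),
      (ip_comm _ _).trans (hac'.trans (ip_comm _ _)),
      (ip_comm _ _).trans (hbc'.trans (ip_comm _ _)), hcc',
      (ip_comm _ _).trans (n3.trans (n3'.symm.trans (ip_comm _ _))),
      n1.trans n1'.symm, n2.trans n2'.symm, n3.trans n3'.symm, n4]
  have hu : IsUnit F.det := isUnit_iff_ne_zero.2 (hd ▸ hne)
  have hut : IsUnit F.transpose.det := by rwa [Matrix.det_transpose]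
  set G := F'.transpose * F.transpose⁻¹ with hG
  have hGF : G * F.transpose = F'.transpose := by
    rw [hG, Matrix.mul_assoc, Matrix.nonsing_inv_mul _ hut, Matrix.mul_one]
  have hGv : ∀ i, G.mulVec (F i) = F' i := by
    intro i
    ext j
    exact congrFun (congrFun hGF j) i
  have hGt : G.transpose = F⁻¹ * F' := by
    rw [hG, Matrix.transpose_mul, Matrix.transpose_transpose, Matrix.transpose_nonsing_inv,
      Matrix.transpose_transpose]
  have hGJ : G.transpose * J * G = J := by
    calc G.transpose * J * G = F⁻¹ * (F' * J * F'.transpose) * F.transpose⁻¹ := by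
          rw [hGt, hG]; simp only [Matrix.mul_assoc]
      _ = (F⁻¹ * F) * J * (F.transpose * F.transpose⁻¹) := by
          rw [← hgram]; simp only [Matrix.mul_assoc]
      _ = J := by
          rw [Matrix.nonsing_inv_mul _ hu, Matrix.mul_nonsing_inv _ hut, Matrix.one_mul,
            Matrix.mul_one]
  have hipJ : ∀ v w : V4, ip v w = v ⬝ᵥ J.mulVec w := by
    intro v w
    simp [hJ, Matrix.mulVec_diagonal, dotProduct, Fin.sum_univ_four, ip]
    ring
  have hiso : ∀ v w : V4, ip (G.mulVec v) (G.mulVec w) = ip v w := by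
    intro v w
    rw [hipJ, hipJ]
    conv_rhs => rw [← hGJ, ← Matrix.mulVec_mulVec, ← Matrix.mulVec_mulVec, Matrix.dotProduct_mulVec,
      Matrix.vecMul_transpose]
  have hGdet : G.det = 1 := by
    have h := congrArg Matrix.det hGF
    rw [Matrix.det_mul, Matrix.det_transpose, Matrix.det_transpose, hd, hd'] at h
    exact (mul_eq_right₀ hne).1 h
  have hGa : G.mulVec a = a' := hGv 0
  have hGb : G.mulVec b = b' := hGv 1
  have hGc : G.mulVec c = c' := hGv 2
  have hGn : G.mulVec n = n' := hGv 3
  refine ⟨Matrix.toLin' G, by simpa using hiso, by rw [LinearMap.det_toLin', hGdet], by simpa,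
    by simpa, by simpa, ?_⟩
  rw [Matrix.toLin'_apply, ← sub_eq_zero]
  refine eq_zero_of_orthogonal ha' hb' hbc'' (hab' ▸ hab) (hcc' ▸ hc) ?_ ?_ ?_ ?_
  · rw [ip_sub_right, ← had', ← hGa, hiso, sub_self]
  · rw [ip_sub_right, ← hbd', ← hGb, hiso, sub_self]
  · rw [ip_sub_right, ← hcd', ← hGc, hiso, sub_self]
  · rw [← ip_cross, ip_sub_right]
    change ip n' _ - ip n' _ = 0
    rw [← hGn, hiso, hGn, ip_cross, ip_cross, hdet, sub_self]

section NullDerivatives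

variable {E : Type*} [NormedAddCommGroup E] [NormedSpace ℝ E]

/-- Derivative in the null direction `s`. -/
def ds (f : ℝ × ℝ → E) (p : ℝ × ℝ) : E := (1 / 2 : ℝ) • (pu f p + pv f p)

/-- Derivative in the null direction `t`. -/
def dt (f : ℝ × ℝ → E) (p : ℝ × ℝ) : E := (1 / 2 : ℝ) • (pu f p - pv f p)

variable {U : Set (ℝ × ℝ)} {f : ℝ × ℝ → E} {o p : ℝ × ℝ} {r s t : ℝ}

theorem contDiffOn_pu (hU : IsOpen U) (hf : ContDiffOn ℝ (⊤ : ℕ∞) f U) :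
    ContDiffOn ℝ (⊤ : ℕ∞) (pu f) U :=
  (hf.fderiv_of_isOpen hU (m := (⊤ : ℕ∞)) (by simp)).clm_apply contDiffOn_const

theorem contDiffOn_pv (hU : IsOpen U) (hf : ContDiffOn ℝ (⊤ : ℕ∞) f U) :
    ContDiffOn ℝ (⊤ : ℕ∞) (pv f) U :=
  (hf.fderiv_of_isOpen hU (m := (⊤ : ℕ∞)) (by simp)).clm_apply contDiffOn_const

theorem contDiffOn_ds (hU : IsOpen U) (hf : ContDiffOn ℝ (⊤ : ℕ∞) f U) :
    ContDiffOn ℝ (⊤ : ℕ∞) (ds f) U :=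
  ((contDiffOn_pu hU hf).add (contDiffOn_pv hU hf)).const_smul _

theorem contDiffOn_dt (hU : IsOpen U) (hf : ContDiffOn ℝ (⊤ : ℕ∞) f U) :
    ContDiffOn ℝ (⊤ : ℕ∞) (dt f) U :=
  ((contDiffOn_pu hU hf).sub (contDiffOn_pv hU hf)).const_smul _

theorem differentiableAt_of_contDiffOn (hU : IsOpen U) (hf : ContDiffOn ℝ (⊤ : ℕ∞) f U)
    (hp : p ∈ U) : DifferentiableAt ℝ f p :=
  (hf.contDiffAt (hU.mem_nhds hp)).differentiableAt (by simp)

theorem pu_pv_comm (hU : IsOpen U) (hf : ContDiffOn ℝ (⊤ : ℕ∞) f U) (hp : p ∈ U) :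
    pu (pv f) p = pv (pu f) p := by
  have hd : DifferentiableAt ℝ (fderiv ℝ f) p :=
    differentiableAt_of_contDiffOn hU (hf.fderiv_of_isOpen hU (by simp)) hp
  have h := (hf.contDiffAt (hU.mem_nhds hp)).isSymmSndFDerivAt (by
    simp only [minSmoothness_of_isRCLikeNormedField]
    exact WithTop.coe_le_coe.2 le_top)
  have e : ∀ v w : ℝ × ℝ, fderiv ℝ (fun q => fderiv ℝ f q v) p w =
      fderiv ℝ (fderiv ℝ f) p w v := by
    intro v w
    rw [fderiv_clm_apply hd (differentiableAt_const v)]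
    simp
  change fderiv ℝ (fun q => fderiv ℝ f q (0, 1)) p (1, 0) =
    fderiv ℝ (fun q => fderiv ℝ f q (1, 0)) p (0, 1)
  rw [e, e]
  exact h _ _

theorem ds_dt_eq (hU : IsOpen U) (hf : ContDiffOn ℝ (⊤ : ℕ∞) f U) (hp : p ∈ U) :
    ds (dt f) p = (1 / 4 : ℝ) • (pu (pu f) p - pv (pv f) p) ∧
    dt (ds f) p = (1 / 4 : ℝ) • (pu (pu f) p - pv (pv f) p) := by
  have hu := differentiableAt_of_contDiffOn hU (contDiffOn_pu hU hf) hp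
  have hv := differentiableAt_of_contDiffOn hU (contDiffOn_pv hU hf) hp
  have h1 : fderiv ℝ (dt f) p = (1 / 2 : ℝ) • (fderiv ℝ (pu f) p - fderiv ℝ (pv f) p) :=
    ((hu.hasFDerivAt.sub hv.hasFDerivAt).const_smul (1 / 2 : ℝ)).fderiv
  have h2 : fderiv ℝ (ds f) p = (1 / 2 : ℝ) • (fderiv ℝ (pu f) p + fderiv ℝ (pv f) p) :=
    ((hu.hasFDerivAt.add hv.hasFDerivAt).const_smul (1 / 2 : ℝ)).fderiv
  have hc := pu_pv_comm hU hf hp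
  simp only [pu, pv] at hc
  constructor
  · simp only [ds, pu, pv, h1, _root_.smul_apply, _root_.sub_apply]
    rw [hc]
    module
  · simp only [dt, pu, pv, h2, _root_.smul_apply, _root_.add_apply]
    rw [hc]
    module

theorem hasDerivAt_ds (hf : DifferentiableAt ℝ f (nullPt o s t)) :
    HasDerivAt (fun s => f (nullPt o s t)) (ds f (nullPt o s t)) s := by
  have hc : HasDerivAt (fun s => nullPt o s t) ((1 / 2 : ℝ), (1 / 2 : ℝ)) s :=
    ((((hasDerivAt_id s).add_const t).div_const 2).const_add o.1).prodMk
      ((((hasDerivAt_id s).sub_const t).div_const 2).const_add o.2)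
  refine (hf.hasFDerivAt.comp_hasDerivAt s hc).congr_deriv ?_
  have e : ((1 / 2 : ℝ), (1 / 2 : ℝ)) = (1 / 2 : ℝ) • (((1, 0) : ℝ × ℝ) + (0, 1)) := by
    ext <;> simp
  rw [e, map_smul, map_add]
  rfl

theorem hasDerivAt_dt (hf : DifferentiableAt ℝ f (nullPt o s t)) :
    HasDerivAt (fun t => f (nullPt o s t)) (dt f (nullPt o s t)) t := by
  have hc : HasDerivAt (fun t => nullPt o s t) ((1 / 2 : ℝ), (-1 / 2 : ℝ)) t :=
    ((((hasDerivAt_id t).const_add s).div_const 2).const_add o.1).prodMk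
      ((((hasDerivAt_id t).const_sub s).div_const 2).const_add o.2)
  refine (hf.hasFDerivAt.comp_hasDerivAt t hc).congr_deriv ?_
  have e : ((1 / 2 : ℝ), (-1 / 2 : ℝ)) = (1 / 2 : ℝ) • (((1, 0) : ℝ × ℝ) - (0, 1)) := by
    ext <;> simp
    norm_num
  rw [e, map_smul, map_sub]
  rfl

/-- D'Alembert's decomposition of solutions of the wave equation. -/
theorem exists_nullSplit {x : ℝ × ℝ → E} (hU : IsOpen U) (hr : 0 < r) (hsub : nullSq o r ⊆ U)
    (hx : ContDiffOn ℝ (⊤ : ℕ∞) x U) (hmin : ∀ p ∈ U, pu (pu x) p - pv (pv x) p = 0) :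
    ∃ α β A B A' B' : ℝ → E, NullSplit o r x α β A B A' B' := by
  have h0 : |(0 : ℝ)| < r := by simpa using hr
  have hmem : ∀ s t, |s| < r → |t| < r → nullPt o s t ∈ U := fun s t hs ht =>
    hsub (nullPt_mem hs ht)
  have hds := contDiffOn_ds hU hx
  have hdt := contDiffOn_dt hU hx
  have dd : ∀ {f : ℝ × ℝ → E}, ContDiffOn ℝ (⊤ : ℕ∞) f U → ∀ {s t : ℝ}, |s| < r → |t| < r →
      DifferentiableAt ℝ f (nullPt o s t) := fun hf _ _ hs ht =>
    differentiableAt_of_contDiffOn hU hf (hmem _ _ hs ht)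
  have hconst : ∀ s t, |s| < r → |t| < r → ds x (nullPt o s t) = ds x (nullPt o s 0) := by
    intro s t hs ht
    refine eq_zero_value_of_hasDerivAt_zero (f := fun t => ds x (nullPt o s t)) ?_ ht
    intro t ht
    refine (hasDerivAt_dt (dd hds hs ht)).congr_deriv ?_
    rw [(ds_dt_eq hU hx (hmem s t hs ht)).2, hmin _ (hmem s t hs ht), smul_zero]
  refine ⟨fun s => x (nullPt o s 0), fun t => x (nullPt o 0 t) - x (nullPt o 0 0),
    fun s => ds x (nullPt o s 0), fun t => dt x (nullPt o 0 t),
    fun s => ds (ds x) (nullPt o s 0), fun t => dt (dt x) (nullPt o 0 t), ?_, ?_, ?_, ?_, ?_⟩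
  · intro p hp
    have h := eq_zero_value_of_hasDerivAt_zero (r := r)
      (f := fun s => x (nullPt o s (nullT o p)) - x (nullPt o s 0)) ?_ hp.1
    · rw [nullPt_null] at h
      rw [← h]; abel
    · intro s hs
      refine ((hasDerivAt_ds (dd hx hs hp.2)).sub (hasDerivAt_ds (dd hx hs h0))).congr_deriv ?_
      rw [hconst _ _ hs hp.2, sub_self]
  · exact fun s hs => hasDerivAt_ds (dd hx hs h0)
  · exact fun t ht => (hasDerivAt_dt (dd hx h0 ht)).sub_const _
  · exact fun s hs => hasDerivAt_ds (dd hds hs h0)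
  · exact fun t ht => hasDerivAt_dt (dd hdt h0 ht)

end NullDerivatives

/-- The invariants of the derivatives of the two null curves of a canonical surface of the second
type with Gauss curvature `K` and normal curvature `κ`. -/
structure NullData (o : ℝ × ℝ) (r : ℝ) (K κ : ℝ × ℝ → ℝ) (A B A' B' : ℝ → V4) : Prop where
  AA : ∀ s, |s| < r → ip (A s) (A s) = 0
  BB : ∀ t, |t| < r → ip (B t) (B t) = 0
  AA' : ∀ s, |s| < r → ip (A s) (A' s) = 0
  BB' : ∀ t, |t| < r → ip (B t) (B' t) = 0
  A'A' : ∀ s, |s| < r → ip (A' s) (A' s) = -1 / 4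
  B'B' : ∀ t, |t| < r → ip (B' t) (B' t) = -1 / 4
  AB_neg : ∀ s t, |s| < r → |t| < r → ip (A s) (B t) < 0
  gauss : ∀ s t, |s| < r → |t| < r → K (nullPt o s t) * ip (A s) (B t) ^ 3 =
    -(ip (A s) (B t) * ip (A' s) (B' t) - ip (A' s) (B t) * ip (A s) (B' t))
  normal : ∀ s t, |s| < r → |t| < r → κ (nullPt o s t) * ip (A s) (B t) ^ 3 =
    - det4 (A s) (B t) (A' s) (B' t)

theorem hasDerivAt_ip_left {X : ℝ → V4} {X' : V4} {s : ℝ} (w : V4) (h : HasDerivAt X X' s) :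
    HasDerivAt (fun s => ip (X s) w) (ip X' w) s := by
  have h := hasDerivAt_pi.1 h
  exact ((((h 0).mul_const _).neg.add ((h 1).mul_const _)).sub ((h 2).mul_const _)).add
    ((h 3).mul_const _)

theorem hasDerivAt_ip_self {X : ℝ → V4} {X' : V4} {s : ℝ} (h : HasDerivAt X X' s) :
    HasDerivAt (fun s => ip (X s) (X s)) (2 * ip (X s) X') s := by
  have h := hasDerivAt_pi.1 h
  refine (((((h 0).mul (h 0)).neg.add ((h 1).mul (h 1))).sub ((h 2).mul (h 2))).add
    ((h 3).mul (h 3))).congr_deriv ?_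
  simp only [ip]; ring

theorem hasDerivAt_unique_of_abs_lt {E : Type*} [NormedAddCommGroup E] [NormedSpace ℝ E]
    {f g : ℝ → E} {f' g' : E} {r s : ℝ} (hf : HasDerivAt f f' s) (hg : HasDerivAt g g' s)
    (h : ∀ s, |s| < r → f s = g s) (hs : |s| < r) : f' = g' := by
  refine hf.unique (hg.congr_of_eventuallyEq ?_)
  filter_upwards [(isOpen_lt continuous_abs continuous_const).mem_nhds hs] with q hq using h q hq

theorem ip_self_deriv_eq_zero {X : ℝ → V4} {X' : V4} {r s : ℝ} (hX : HasDerivAt X X' s)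
    (h : ∀ s, |s| < r → ip (X s) (X s) = 0) (hs : |s| < r) : ip (X s) X' = 0 := by
  have := hasDerivAt_unique_of_abs_lt (hasDerivAt_ip_self hX) (hasDerivAt_const s (0 : ℝ)) h hs
  linarith

theorem nullData_of_goodSurf {o : ℝ × ℝ} {r : ℝ} {D : Set (ℝ × ℝ)} {x : ℝ × ℝ → V4}
    {K κ : ℝ × ℝ → ℝ} {α β A B A' B' : ℝ → V4} (h : NullSplit o r x α β A B A' B') (hr : 0 < r)
    (hsub : nullSq o r ⊆ D) (hx : GoodSurf D x)
    (hK : ∀ p ∈ D, GaussK x p = K p ∧ NormK x p = κ p) : NullData o r K κ A B A' B' := by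
  obtain ⟨-, hiso, -, hcan⟩ := hx
  have h0 : |(0 : ℝ)| < r := by simpa using hr
  have hu : ∀ s t, |s| < r → |t| < r → pu x (nullPt o s t) = A s + B t := fun s t hs ht => by
    rw [h.pu_eq (nullPt_mem hs ht), nullS_nullPt, nullT_nullPt]
  have hv : ∀ s t, |s| < r → |t| < r → pv x (nullPt o s t) = A s - B t := fun s t hs ht => by
    rw [h.pv_eq (nullPt_mem hs ht), nullS_nullPt, nullT_nullPt]
  have huu : ∀ s t, |s| < r → |t| < r → pu (pu x) (nullPt o s t) = A' s + B' t :=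
    fun s t hs ht => by
      rw [h.pu_pu_eq (nullPt_mem hs ht), nullS_nullPt, nullT_nullPt]
  have huv : ∀ s t, |s| < r → |t| < r → pv (pu x) (nullPt o s t) = A' s - B' t :=
    fun s t hs ht => by
      rw [h.pv_pu_eq (nullPt_mem hs ht), nullS_nullPt, nullT_nullPt]
  have key : ∀ s t, |s| < r → |t| < r →
      ip (A s) (A s) = 0 ∧ ip (B t) (B t) = 0 ∧ ip (A s) (B t) < 0 := by
    intro s t hs ht
    obtain ⟨h1, h2, h3⟩ := hiso _ (hsub (nullPt_mem (o := o) hs ht))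
    rw [Ef, hu s t hs ht] at h1 h2
    rw [hu s t hs ht] at h3
    rw [hv s t hs ht] at h2 h3
    simp only [ip_add_left, ip_add_right, ip_sub_left, ip_sub_right, ip_comm (B t) (A s)]
      at h1 h2 h3
    refine ⟨?_, ?_, ?_⟩ <;> linarith
  have hAA : ∀ s, |s| < r → ip (A s) (A s) = 0 := fun s hs => (key s 0 hs h0).1
  have hBB : ∀ t, |t| < r → ip (B t) (B t) = 0 := fun t ht => (key 0 t h0 ht).2.1
  have hAA' : ∀ s, |s| < r → ip (A s) (A' s) = 0 := fun s hs =>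
    ip_self_deriv_eq_zero (h.dA s hs) hAA hs
  have hBB' : ∀ t, |t| < r → ip (B t) (B' t) = 0 := fun t ht =>
    ip_self_deriv_eq_zero (h.dB t ht) hBB ht
  have hN : ∀ s t, |s| < r → |t| < r → ip (A s) (B t) < 0 := fun s t hs ht => (key s t hs ht).2.2
  have inv := fun s t hs ht => invariants_null (hu s t hs ht) (hv s t hs ht) (huu s t hs ht)
    (huv s t hs ht) (hAA s hs) (hBB t ht) (hN s t hs ht).ne (hAA' s hs) (hBB' t ht)
  have hc : ∀ s t, |s| < r → |t| < r → ip (A' s) (A' s) = -1 / 4 ∧ ip (B' t) (B' t) = -1 / 4 := by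
    intro s t hs ht
    obtain ⟨i1, i2, -, -⟩ := inv s t hs ht
    obtain ⟨c1, c2⟩ := hcan _ (hsub (nullPt_mem (o := o) hs ht))
    rw [c1] at i1
    rw [c2] at i2
    constructor <;> linarith
  refine ⟨hAA, hBB, hAA', hBB', fun s hs => (hc s 0 hs h0).1, fun t ht => (hc 0 t h0 ht).2, hN,
    fun s t hs ht => ?_, fun s t hs ht => ?_⟩
  · rw [← (hK _ (hsub (nullPt_mem hs ht))).1, (inv s t hs ht).2.2.1,
      div_mul_cancel₀ _ (pow_ne_zero _ (hN s t hs ht).ne)]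
  · rw [← (hK _ (hsub (nullPt_mem hs ht))).2, (inv s t hs ht).2.2.2,
      div_mul_cancel₀ _ (pow_ne_zero _ (hN s t hs ht).ne)]

theorem NullData.metric_eq {o : ℝ × ℝ} {r : ℝ} {K κ : ℝ × ℝ → ℝ} {A B A' B' : ℝ → V4}
    (h : NullData o r K κ A B A' B') {s t : ℝ} (hs : |s| < r) (ht : |t| < r) :
    16 * ip (A s) (B t) ^ 4 * (K (nullPt o s t) ^ 2 - κ (nullPt o s t) ^ 2) = 1 := by
  have h1 := det4_sq (h.AA s hs) (h.BB t ht) (h.AA' s hs) (h.BB' t ht)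
  have h2 := h.gauss s t hs ht
  have h3 := h.normal s t hs ht
  have hN := (h.AB_neg s t hs ht).ne
  rw [h.A'A' s hs, h.B'B' t ht] at h1
  set N := ip (A s) (B t)
  have h4 : det4 (A s) (B t) (A' s) (B' t) = - (κ (nullPt o s t) * N ^ 3) := by linarith
  have h5 : N * ip (A' s) (B' t) - ip (A' s) (B t) * ip (A s) (B' t) =
    - (K (nullPt o s t) * N ^ 3) := by linarith
  rw [h4, h5] at h1
  refine mul_left_cancel₀ (pow_ne_zero 2 hN) ?_
  linear_combination (-16) * h1

theorem det4_map (G : V4 →ₗ[ℝ] V4) (a b c d : V4) :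
    det4 (G a) (G b) (G c) (G d) = LinearMap.det G * det4 a b c d := by
  rw [det4, det4, ← LinearMap.det_toMatrix', ← Matrix.det_mul]
  congr 1
  ext i j
  rw [Matrix.mul_apply]
  have e : ∀ v : V4, G v i = ∑ k, LinearMap.toMatrix' G i k * v k := by
    intro v
    conv_lhs => rw [← LinearMap.toMatrix'_mulVec]
    rfl
  fin_cases j <;> exact e _

/-- Surfaces with the same curvatures have congruent null curves. -/
theorem NullData.congruent {o : ℝ × ℝ} {r : ℝ} {K κ : ℝ × ℝ → ℝ}
    {A B A' B' C D C' D' : ℝ → V4} (hr : 0 < r)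
    (h : NullData o r K κ A B A' B') (h' : NullData o r K κ C D C' D')
    (hA : ∀ s, |s| < r → HasDerivAt A (A' s) s) (hB : ∀ s, |s| < r → HasDerivAt B (B' s) s)
    (hC : ∀ s, |s| < r → HasDerivAt C (C' s) s) (hD : ∀ s, |s| < r → HasDerivAt D (D' s) s) :
    ∃ G : V4 →ₗ[ℝ] V4, (∀ v w, ip (G v) (G w) = ip v w) ∧ LinearMap.det G = 1 ∧
      (∀ s, |s| < r → G (A s) = C s) ∧ ∀ t, |t| < r → G (B t) = D t := by
  have h0 : |(0 : ℝ)| < r := by simpa using hr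
  have e1 : ∀ s t, |s| < r → |t| < r → ip (A s) (B t) = ip (C s) (D t) := by
    intro s t hs ht
    have m1 := h.metric_eq hs ht
    have m2 := h'.metric_eq hs ht
    have hne : 16 * (K (nullPt o s t) ^ 2 - κ (nullPt o s t) ^ 2) ≠ 0 := by
      intro h0
      have : ip (A s) (B t) ^ 4 * (16 * (K (nullPt o s t) ^ 2 - κ (nullPt o s t) ^ 2)) = 1 := by
        linarith
      rw [h0] at this
      simp at this
    have m3 : (-ip (A s) (B t)) ^ 4 = (-ip (C s) (D t)) ^ 4 :=
      mul_right_cancel₀ hne (by linarith)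
    have := (pow_left_inj₀ (by linarith [h.AB_neg s t hs ht]) (by linarith [h'.AB_neg s t hs ht])
      (by norm_num : (4 : ℕ) ≠ 0)).1 m3
    linarith
  have e2 : ∀ s t, |s| < r → |t| < r → ip (A' s) (B t) = ip (C' s) (D t) := fun s t hs ht =>
    hasDerivAt_unique_of_abs_lt (hasDerivAt_ip_left (B t) (hA s hs))
      (hasDerivAt_ip_left (D t) (hC s hs)) (fun s hs => e1 s t hs ht) hs
  have e3 : ∀ s t, |s| < r → |t| < r → ip (A s) (B' t) = ip (C s) (D' t) := fun s t hs ht => by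
    rw [ip_comm, ip_comm (C s)]
    exact hasDerivAt_unique_of_abs_lt (hasDerivAt_ip_left (A s) (hB t ht))
      (hasDerivAt_ip_left (C s) (hD t ht))
      (fun t ht => by rw [ip_comm, ip_comm (D t)]; exact e1 s t hs ht) ht
  have e4 : ∀ s t, |s| < r → |t| < r →
      det4 (A s) (B t) (A' s) (B' t) = det4 (C s) (D t) (C' s) (D' t) := by
    intro s t hs ht
    have m1 := h.normal s t hs ht
    have m2 := h'.normal s t hs ht
    rw [e1 s t hs ht] at m1
    linarith
  have e5 : ip (A' 0) (B' 0) = ip (C' 0) (D' 0) := by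
    have m1 := h.gauss 0 0 h0 h0
    have m2 := h'.gauss 0 0 h0 h0
    rw [e1 0 0 h0 h0, e2 0 0 h0 h0, e3 0 0 h0 h0] at m1
    exact mul_left_cancel₀ (h'.AB_neg 0 0 h0 h0).ne (by linarith)
  obtain ⟨G, hG, hdet, gA, gB, gB', gA'⟩ := exists_proper_isometry (a := A 0) (b := B 0)
    (c := B' 0) (d := A' 0) (a' := C 0) (b' := D 0) (c' := D' 0) (d' := C' 0) (h.AA 0 h0)
    (h.BB 0 h0) (h.BB' 0 h0) (h.AB_neg 0 0 h0 h0).ne (by rw [h.B'B' 0 h0]; norm_num)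
    (by rw [h.AA 0 h0, h'.AA 0 h0]) (by rw [h.BB 0 h0, h'.BB 0 h0])
    (by rw [h.B'B' 0 h0, h'.B'B' 0 h0]) (e1 0 0 h0 h0) (e3 0 0 h0 h0)
    (by rw [h.BB' 0 h0, h'.BB' 0 h0]) (by rw [h.AA' 0 h0, h'.AA' 0 h0])
    (by rw [ip_comm, ip_comm (D 0)]; exact e2 0 0 h0 h0)
    (by rw [ip_comm, ip_comm (D' 0)]; exact e5)
    (by rw [det4_swap_last, e4 0 0 h0 h0, det4_swap_last (C 0), neg_neg])
  have gdet : ∀ a b c d, det4 (G a) (G b) (G c) (G d) = det4 a b c d := fun a b c d => by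
    rw [det4_map, hdet, one_mul]
  have dG : ∀ {X : ℝ → V4} {X' : V4} {s : ℝ}, HasDerivAt X X' s →
      HasDerivAt (fun s => G (X s)) (G X') s := fun hX =>
    (LinearMap.toContinuousLinearMap G).hasFDerivAt.comp_hasDerivAt _ hX
  refine ⟨G, hG, hdet, fun s hs => ?_, fun t ht => ?_⟩
  · refine null_curve_unique (A := fun s => G (A s)) (b := D 0) (b' := D' 0)
      (fun s hs => dG (hA s hs)) hC (fun s hs => by rw [hG, h.AA s hs]) h'.AA (h'.BB 0 h0)
      (h'.BB' 0 h0) (by rw [h'.B'B' 0 h0]; norm_num) gA (fun s hs => ?_) (fun s hs => ?_)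
      (fun s hs => ?_) (fun s hs => ?_) hs
    · rw [← gB, hG]; exact (h.AB_neg s 0 hs h0).ne
    · rw [← gB, hG, gB, e1 s 0 hs h0]
    · rw [← gB', hG, gB', e3 s 0 hs h0]
    · rw [← gB, ← gB', gdet, gB, gB', e4 s 0 hs h0]
  · refine null_curve_unique (A := fun s => G (B s)) (b := C 0) (b' := C' 0)
      (fun s hs => dG (hB s hs)) hD (fun s hs => by rw [hG, h.BB s hs]) h'.BB (h'.AA 0 h0)
      (h'.AA' 0 h0) (by rw [h'.A'A' 0 h0]; norm_num) gB (fun t ht => ?_) (fun t ht => ?_)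
      (fun t ht => ?_) (fun t ht => ?_) ht
    · rw [← gA, hG, ip_comm]; exact (h.AB_neg 0 t h0 ht).ne
    · rw [← gA, hG, gA, ip_comm, e1 0 t h0 ht, ip_comm]
    · rw [← gA', hG, gA', ip_comm, e2 0 t h0 ht, ip_comm]
    · rw [← gA, ← gA', gdet, gA, gA', det4_swap_pairs, e4 0 t h0 ht, det4_swap_pairs (C 0)]

/-- Local uniqueness up to a proper motion. -/
theorem exists_motion_of_goodSurf {D₁ D₂ : Set (ℝ × ℝ)} {o : ℝ × ℝ} {K κ : ℝ × ℝ → ℝ}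
    {x₁ x₂ : ℝ × ℝ → V4} (hD₁ : IsOpen D₁) (ho₁ : o ∈ D₁) (hx₁ : GoodSurf D₁ x₁)
    (hK₁ : ∀ p ∈ D₁, GaussK x₁ p = K p ∧ NormK x₁ p = κ p)
    (hD₂ : IsOpen D₂) (ho₂ : o ∈ D₂) (hx₂ : GoodSurf D₂ x₂)
    (hK₂ : ∀ p ∈ D₂, GaussK x₂ p = K p ∧ NormK x₂ p = κ p) :
    ∃ (D₃ : Set (ℝ × ℝ)) (A : V4 →ₗ[ℝ] V4) (c : V4), IsOpen D₃ ∧ o ∈ D₃ ∧ D₃ ⊆ D₁ ∩ D₂ ∧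
      (∀ v w : V4, ip (A v) (A w) = ip v w) ∧ LinearMap.det A = 1 ∧
      ∀ p ∈ D₃, x₂ p = A (x₁ p) + c := by
  obtain ⟨r, hr, hsub⟩ := exists_nullSq_subset (hD₁.inter hD₂) ⟨ho₁, ho₂⟩
  have hsub₁ : nullSq o r ⊆ D₁ := hsub.trans Set.inter_subset_left
  have hsub₂ : nullSq o r ⊆ D₂ := hsub.trans Set.inter_subset_right
  obtain ⟨α₁, β₁, A₁, B₁, A₁', B₁', h₁⟩ := exists_nullSplit hD₁ hr hsub₁ hx₁.1 hx₁.2.2.1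
  obtain ⟨α₂, β₂, A₂, B₂, A₂', B₂', h₂⟩ := exists_nullSplit hD₂ hr hsub₂ hx₂.1 hx₂.2.2.1
  obtain ⟨G, hG, hdet, gA, gB⟩ := (nullData_of_goodSurf h₁ hr hsub₁ hx₁ hK₁).congruent hr
    (nullData_of_goodSurf h₂ hr hsub₂ hx₂ hK₂) h₁.dA h₁.dB h₂.dA h₂.dB
  have dG : ∀ {X : ℝ → V4} {X' : V4} {s : ℝ}, HasDerivAt X X' s →
      HasDerivAt (fun s => G (X s)) (G X') s := fun hX =>
    (LinearMap.toContinuousLinearMap G).hasFDerivAt.comp_hasDerivAt _ hX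
  refine ⟨nullSq o r, G, (α₂ 0 - G (α₁ 0)) + (β₂ 0 - G (β₁ 0)), isOpen_nullSq o r,
    self_mem_nullSq o hr, hsub, hG, hdet, fun p hp => ?_⟩
  have ca := eq_zero_value_of_hasDerivAt_zero (r := r) (f := fun s => α₂ s - G (α₁ s))
    (fun s hs => ((h₂.dα s hs).sub (dG (h₁.dα s hs))).congr_deriv (by rw [gA s hs, sub_self])) hp.1
  have cb := eq_zero_value_of_hasDerivAt_zero (r := r) (f := fun s => β₂ s - G (β₁ s))
    (fun s hs => ((h₂.dβ s hs).sub (dG (h₁.dβ s hs))).congr_deriv (by rw [gB s hs, sub_self])) hp.2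
  rw [h₁.eq p hp, h₂.eq p hp, map_add, ← ca, ← cb]
  abel

/-- The real model `ℝ² ⊗ ℝ² ≅ ℝ⁴₂`: the vector corresponding to a decomposable tensor. -/
def tens (y₁ y₂ w₁ w₂ : ℝ) : V4 :=
  ![(y₂ * w₂ - y₁ * w₁) / 2, (y₁ * w₁ + y₂ * w₂) / 2, (y₁ * w₂ + y₂ * w₁) / 2,
    (y₂ * w₁ - y₁ * w₂) / 2]

theorem ip_tens (y₁ y₂ w₁ w₂ z₁ z₂ v₁ v₂ : ℝ) :
    ip (tens y₁ y₂ w₁ w₂) (tens z₁ z₂ v₁ v₂) =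
      (y₁ * z₂ - y₂ * z₁) * (w₁ * v₂ - w₂ * v₁) / 2 := by
  simp [ip, tens]
  ring

theorem det4_tens (y₁ y₂ y₁' y₂' w₁ w₂ w₁' w₂' z₁ z₂ z₁' z₂' v₁ v₂ v₁' v₂' : ℝ) :
    det4 (tens y₁ y₂ w₁ w₂) (tens z₁ z₂ v₁ v₂)
      (tens y₁' y₂' w₁ w₂ + tens y₁ y₂ w₁' w₂') (tens z₁' z₂' v₁ v₂ + tens z₁ z₂ v₁' v₂') =
      ((w₁ * w₂' - w₁' * w₂) * (v₁ * v₂' - v₁' * v₂) * (y₁ * z₂ - y₂ * z₁) ^ 2 -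
        (y₁ * y₂' - y₁' * y₂) * (z₁ * z₂' - z₁' * z₂) * (w₁ * v₂ - w₂ * v₁) ^ 2) / 4 := by
  rw [det4_eq]
  simp [tens]
  ring

theorem ip_tens_mul_sub (y₁ y₂ y₁' y₂' w₁ w₂ w₁' w₂' z₁ z₂ z₁' z₂' v₁ v₂ v₁' v₂' : ℝ) :
    ip (tens y₁ y₂ w₁ w₂) (tens z₁ z₂ v₁ v₂) *
        ip (tens y₁' y₂' w₁ w₂ + tens y₁ y₂ w₁' w₂') (tens z₁' z₂' v₁ v₂ + tens z₁ z₂ v₁' v₂') -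
      ip (tens y₁' y₂' w₁ w₂ + tens y₁ y₂ w₁' w₂') (tens z₁ z₂ v₁ v₂) *
        ip (tens y₁ y₂ w₁ w₂) (tens z₁' z₂' v₁ v₂ + tens z₁ z₂ v₁' v₂') =
      ((w₁ * w₂' - w₁' * w₂) * (v₁ * v₂' - v₁' * v₂) * (y₁ * z₂ - y₂ * z₁) ^ 2 +
        (y₁ * y₂' - y₁' * y₂) * (z₁ * z₂' - z₁' * z₂) * (w₁ * v₂ - w₂ * v₁) ^ 2) / 4 := by
  simp only [ip_add_left, ip_add_right, ip_tens]
  ring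

theorem ip_tens_self (y₁ y₂ w₁ w₂ : ℝ) : ip (tens y₁ y₂ w₁ w₂) (tens y₁ y₂ w₁ w₂) = 0 := by
  rw [ip_tens]; ring

theorem ip_tens_deriv (y₁ y₂ y₁' y₂' w₁ w₂ w₁' w₂' : ℝ) :
    ip (tens y₁ y₂ w₁ w₂) (tens y₁' y₂' w₁ w₂ + tens y₁ y₂ w₁' w₂') = 0 := by
  rw [ip_add_right, ip_tens, ip_tens]; ring

theorem ip_tens_deriv_self (y₁ y₂ y₁' y₂' w₁ w₂ w₁' w₂' : ℝ) :
    ip (tens y₁' y₂' w₁ w₂ + tens y₁ y₂ w₁' w₂') (tens y₁' y₂' w₁ w₂ + tens y₁ y₂ w₁' w₂') =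
      -((y₁ * y₂' - y₁' * y₂) * (w₁ * w₂' - w₁' * w₂)) := by
  simp only [ip_add_left, ip_add_right, ip_tens]
  ring

theorem hasDerivAt_tens {y₁ y₂ w₁ w₂ : ℝ → ℝ} {y₁' y₂' w₁' w₂' s : ℝ}
    (hy₁ : HasDerivAt y₁ y₁' s) (hy₂ : HasDerivAt y₂ y₂' s)
    (hw₁ : HasDerivAt w₁ w₁' s) (hw₂ : HasDerivAt w₂ w₂' s) :
    HasDerivAt (fun s => tens (y₁ s) (y₂ s) (w₁ s) (w₂ s))
      (tens y₁' y₂' (w₁ s) (w₂ s) + tens (y₁ s) (y₂ s) w₁' w₂') s := by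
  rw [hasDerivAt_pi]
  intro i
  fin_cases i
  · refine (((hy₂.mul hw₂).sub (hy₁.mul hw₁)).div_const 2).congr_deriv ?_
    simp [tens]; ring
  · refine (((hy₁.mul hw₁).add (hy₂.mul hw₂)).div_const 2).congr_deriv ?_
    simp [tens]; ring
  · refine (((hy₁.mul hw₂).add (hy₂.mul hw₁)).div_const 2).congr_deriv ?_
    simp [tens]; ring
  · refine (((hy₂.mul hw₁).sub (hy₁.mul hw₂)).div_const 2).congr_deriv ?_
    simp [tens]; ring

theorem contDiffOn_tens {I : Set ℝ} {y₁ y₂ w₁ w₂ : ℝ → ℝ}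
    (hy₁ : ContDiffOn ℝ (⊤ : ℕ∞) y₁ I) (hy₂ : ContDiffOn ℝ (⊤ : ℕ∞) y₂ I)
    (hw₁ : ContDiffOn ℝ (⊤ : ℕ∞) w₁ I) (hw₂ : ContDiffOn ℝ (⊤ : ℕ∞) w₂ I) :
    ContDiffOn ℝ (⊤ : ℕ∞) (fun s => tens (y₁ s) (y₂ s) (w₁ s) (w₂ s)) I := by
  rw [contDiffOn_pi]
  intro i
  fin_cases i
  · exact ((hy₂.mul hw₂).sub (hy₁.mul hw₁)).div_const 2
  · exact ((hy₁.mul hw₁).add (hy₂.mul hw₂)).div_const 2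
  · exact ((hy₁.mul hw₂).add (hy₂.mul hw₁)).div_const 2
  · exact ((hy₂.mul hw₁).sub (hy₁.mul hw₂)).div_const 2

theorem exists_smooth_antideriv {A : ℝ → V4} {r : ℝ} (hr : 0 < r)
    (hA : ContDiffOn ℝ (⊤ : ℕ∞) A (Set.Ioo (-r) r)) :
    ∃ α : ℝ → V4, ContDiffOn ℝ (⊤ : ℕ∞) α (Set.Ioo (-r) r) ∧
      ∀ s, |s| < r → HasDerivAt α (A s) s := by
  have hd : ∀ s, |s| < r → HasDerivAt (fun s => ∫ y in (0 : ℝ)..s, A y) (A s) s := by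
    intro s hs
    have hs' : s ∈ Set.Ioo (-r) r := abs_lt.1 hs
    have hsub : Set.uIcc 0 s ⊆ Set.Ioo (-r) r :=
      (Set.ordConnected_Ioo).uIcc_subset ⟨by linarith, hr⟩ hs'
    exact intervalIntegral.integral_hasDerivAt_right
      (hA.continuousOn.mono hsub).intervalIntegrable
      (hA.continuousOn.stronglyMeasurableAtFilter isOpen_Ioo s hs')
      (hA.continuousOn.continuousAt (isOpen_Ioo.mem_nhds hs'))
  refine ⟨_, ?_, hd⟩
  refine (contDiffOn_infty_iff_deriv_of_isOpen isOpen_Ioo).2 ⟨fun s hs =>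
    (hd s (abs_lt.2 hs)).differentiableAt.differentiableWithinAt, ?_⟩
  exact hA.congr fun s hs => (hd s (abs_lt.2 hs)).deriv

/-- The general solution of Liouville's equation, in terms of two planar curves with constant
Wronskians. -/
structure LiouvilleFactor (o : ℝ × ℝ) (r k : ℝ) (m : ℝ × ℝ → ℝ) (y₁ y₂ z₁ z₂ : ℝ → ℝ) :
    Prop where
  cy₁ : ContDiffOn ℝ (⊤ : ℕ∞) y₁ (Set.Ioo (-r) r)
  cy₂ : ContDiffOn ℝ (⊤ : ℕ∞) y₂ (Set.Ioo (-r) r)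
  cz₁ : ContDiffOn ℝ (⊤ : ℕ∞) z₁ (Set.Ioo (-r) r)
  cz₂ : ContDiffOn ℝ (⊤ : ℕ∞) z₂ (Set.Ioo (-r) r)
  wy : ∀ s, |s| < r → y₁ s * deriv y₂ s - deriv y₁ s * y₂ s = k
  wz : ∀ t, |t| < r → z₁ t * deriv z₂ t - deriv z₁ t * z₂ t = 1
  eq : ∀ s t, |s| < r → |t| < r → m (nullPt o s t) = y₁ s * z₂ t - y₂ s * z₁ t

theorem hasDerivAt_of_contDiffOn_Ioo {y : ℝ → ℝ} {r s : ℝ}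
    (hy : ContDiffOn ℝ (⊤ : ℕ∞) y (Set.Ioo (-r) r)) (hs : |s| < r) :
    HasDerivAt y (deriv y s) s :=
  ((hy.contDiffAt (isOpen_Ioo.mem_nhds (abs_lt.1 hs))).differentiableAt (by simp)).hasDerivAt

/-- The surface built from two solutions of Liouville's equation. -/
theorem exists_goodSurf_of_liouvilleFactor {o : ℝ × ℝ} {r k : ℝ} (hr : 0 < r)
    (hk : k ^ 2 = 1 / 16) {m n : ℝ × ℝ → ℝ} {y₁ y₂ z₁ z₂ w₁ w₂ v₁ v₂ : ℝ → ℝ}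
    (hm : LiouvilleFactor o r k m y₁ y₂ z₁ z₂) (hn : LiouvilleFactor o r k n w₁ w₂ v₁ v₂)
    (m_pos : ∀ p, 0 < m p) (n_pos : ∀ p, 0 < n p) :
    ∃ x : ℝ × ℝ → V4, GoodSurf (nullSq o r) x ∧ ∀ p ∈ nullSq o r,
      GaussK x p = 2 * k * (m p ^ 2 + n p ^ 2) / (m p ^ 3 * n p ^ 3) ∧
      NormK x p = 2 * k * (m p ^ 2 - n p ^ 2) / (m p ^ 3 * n p ^ 3) := by
  obtain ⟨α, cα, dα⟩ := exists_smooth_antideriv hr (contDiffOn_tens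
    (contDiffOn_const (c := (2 : ℝ)).mul hm.cy₁) (contDiffOn_const (c := (2 : ℝ)).mul hm.cy₂)
    hn.cy₁ hn.cy₂)
  obtain ⟨β, cβ, dβ⟩ := exists_smooth_antideriv hr (contDiffOn_tens
    (contDiffOn_const (c := (-1 / 2 : ℝ)).mul hm.cz₁)
    (contDiffOn_const (c := (-1 / 2 : ℝ)).mul hm.cz₂) hn.cz₁ hn.cz₂)
  have hsp : NullSplit o r (fun p => α (nullS o p) + β (nullT o p)) α β _ _ _ _ :=
    { eq := fun _ _ => rfl
      dα := dα
      dβ := dβ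
      dA := fun s hs => hasDerivAt_tens ((hasDerivAt_of_contDiffOn_Ioo hm.cy₁ hs).const_mul 2)
        ((hasDerivAt_of_contDiffOn_Ioo hm.cy₂ hs).const_mul 2)
        (hasDerivAt_of_contDiffOn_Ioo hn.cy₁ hs) (hasDerivAt_of_contDiffOn_Ioo hn.cy₂ hs)
      dB := fun t ht => hasDerivAt_tens
        ((hasDerivAt_of_contDiffOn_Ioo hm.cz₁ ht).const_mul (-1 / 2))
        ((hasDerivAt_of_contDiffOn_Ioo hm.cz₂ ht).const_mul (-1 / 2))
        (hasDerivAt_of_contDiffOn_Ioo hn.cz₁ ht) (hasDerivAt_of_contDiffOn_Ioo hn.cz₂ ht) }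
  have key : ∀ p ∈ nullSq o r, _ ∧ _ := fun p hp => ⟨hm.eq _ _ hp.1 hp.2, hn.eq _ _ hp.1 hp.2⟩
  simp only [nullPt_null] at key
  have hN : ∀ p ∈ nullSq o r,
      ip (tens (2 * y₁ (nullS o p)) (2 * y₂ (nullS o p)) (w₁ (nullS o p)) (w₂ (nullS o p)))
        (tens (-1 / 2 * z₁ (nullT o p)) (-1 / 2 * z₂ (nullT o p)) (v₁ (nullT o p))
          (v₂ (nullT o p))) = -(m p * n p) / 2 := by
    intro p hp
    rw [ip_tens, (key p hp).1, (key p hp).2]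
    ring
  have mn_pos : ∀ p, 0 < m p * n p := fun p => mul_pos (m_pos p) (n_pos p)
  have inv : ∀ p ∈ nullSq o r, _ := fun p hp => invariants_null (hsp.pu_eq hp) (hsp.pv_eq hp)
    (hsp.pu_pu_eq hp) (hsp.pv_pu_eq hp) (ip_tens_self ..) (ip_tens_self ..)
    (by rw [hN p hp]; linarith [mn_pos p]) (ip_tens_deriv ..) (ip_tens_deriv ..)
  have w1 : ∀ a b c d e : ℝ, a * b - c * d = e → 2 * a * (2 * b) - 2 * c * (2 * d) = 4 * e := by
    intro a b c d e h; rw [← h]; ring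
  have w2 : ∀ a b c d e : ℝ, a * b - c * d = e →
      -1 / 2 * a * (-1 / 2 * b) - -1 / 2 * c * (-1 / 2 * d) = e / 4 := by
    intro a b c d e h; rw [← h]; ring
  refine ⟨fun p => α (nullS o p) + β (nullT o p), ⟨?_, ?_, ?_, ?_⟩, ?_⟩
  · have hS : ContDiff ℝ (⊤ : ℕ∞) (nullS o) := by unfold nullS; fun_prop
    have hT : ContDiff ℝ (⊤ : ℕ∞) (nullT o) := by unfold nullT; fun_prop
    exact (cα.comp hS.contDiffOn fun p hp => abs_lt.1 hp.1).add
      (cβ.comp hT.contDiffOn fun p hp => abs_lt.1 hp.2)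
  · intro p hp
    rw [Ef, hsp.pu_eq hp, hsp.pv_eq hp]
    simp only [ip_add_left, ip_add_right, ip_sub_left, ip_sub_right, ip_tens_self]
    rw [ip_comm (tens (-1 / 2 * _) _ _ _), hN p hp]
    exact ⟨by linarith [mn_pos p], by ring, by ring⟩
  · intro p hp
    rw [hsp.pu_pu_eq hp, hsp.pv_pv_eq hp, sub_self]
  · intro p hp
    obtain ⟨h1, h2, -, -⟩ := inv p hp
    rw [h1, h2, ip_tens_deriv_self, ip_tens_deriv_self, w1 _ _ _ _ _ (hm.wy _ hp.1),
      w2 _ _ _ _ _ (hm.wz _ hp.2), hn.wy _ hp.1, hn.wz _ hp.2]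
    constructor <;> linarith
  · intro p hp
    obtain ⟨-, -, h1, h2⟩ := inv p hp
    have e1 : 2 * y₁ (nullS o p) * (-1 / 2 * z₂ (nullT o p)) -
        2 * y₂ (nullS o p) * (-1 / 2 * z₁ (nullT o p)) = - m p := by rw [(key p hp).1]; ring
    have hmp := (m_pos p).ne'
    have hnp := (n_pos p).ne'
    constructor
    · rw [h1, ip_tens_mul_sub, w1 _ _ _ _ _ (hm.wy _ hp.1), w2 _ _ _ _ _ (hm.wz _ hp.2),
        hn.wy _ hp.1, hn.wz _ hp.2, hN p hp, e1, ← (key p hp).2]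
      field_simp
      ring
    · rw [h2, det4_tens, w1 _ _ _ _ _ (hm.wy _ hp.1), w2 _ _ _ _ _ (hm.wz _ hp.2),
        hn.wy _ hp.1, hn.wz _ hp.2, hN p hp, e1, ← (key p hp).2]
      field_simp
      ring

/-- Three solutions of `y'' = Q y` on an interval are linearly dependent. -/
theorem eq_combination_of_same_ode {r k : ℝ} {Q f f' g g' h h' : ℝ → ℝ}
    (hf : ∀ s, |s| < r → HasDerivAt f (f' s) s) (hf' : ∀ s, |s| < r → HasDerivAt f' (Q s * f s) s)
    (hg : ∀ s, |s| < r → HasDerivAt g (g' s) s) (hg' : ∀ s, |s| < r → HasDerivAt g' (Q s * g s) s)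
    (hh : ∀ s, |s| < r → HasDerivAt h (h' s) s) (hh' : ∀ s, |s| < r → HasDerivAt h' (Q s * h s) s)
    (hk : k ≠ 0) (hW : f 0 * g' 0 - f' 0 * g 0 = k) {s : ℝ} (hs : |s| < r) :
    f s * g' s - f' s * g s = k ∧
      h s = f s * ((g' 0 * h 0 - g 0 * h' 0) / k) - g s * ((f' 0 * h 0 - f 0 * h' 0) / k) := by
  have wr : ∀ {a a' b b' : ℝ → ℝ}, (∀ s, |s| < r → HasDerivAt a (a' s) s) →
      (∀ s, |s| < r → HasDerivAt a' (Q s * a s) s) → (∀ s, |s| < r → HasDerivAt b (b' s) s) →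
      (∀ s, |s| < r → HasDerivAt b' (Q s * b s) s) →
      a s * b' s - a' s * b s = a 0 * b' 0 - a' 0 * b 0 := by
    intro a a' b b' ha ha' hb hb'
    refine eq_zero_value_of_hasDerivAt_zero (f := fun s => a s * b' s - a' s * b s) ?_ hs
    intro s hs
    refine (((ha s hs).mul (hb' s hs)).sub ((ha' s hs).mul (hb s hs))).congr_deriv ?_
    ring
  have h1 := wr hf hf' hg hg'
  have h2 := wr hf hf' hh hh'
  have h3 := wr hg hg' hh hh'
  rw [hW] at h1
  refine ⟨h1, ?_⟩
  field_simp
  linear_combination (-h s) * h1 + g s * h2 - f s * h3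

/-- Liouville's theorem on the equation `L_st = k exp (-2 L)`. -/
theorem exists_liouvilleFactor {U : Set (ℝ × ℝ)} {o : ℝ × ℝ} {r k : ℝ} {l : ℝ × ℝ → ℝ}
    (hU : IsOpen U) (hr : 0 < r) (hsub : nullSq o r ⊆ U) (hl : ContDiffOn ℝ (⊤ : ℕ∞) l U)
    (hk : k ≠ 0) (hL : ∀ p ∈ nullSq o r, dt (ds l) p = k * Real.exp (-2 * l p)) :
    ∃ y₁ y₂ z₁ z₂ : ℝ → ℝ, LiouvilleFactor o r k (fun p => Real.exp (l p)) y₁ y₂ z₁ z₂ := by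
  have h0 : |(0 : ℝ)| < r := by simpa using hr
  have hmem : ∀ {s t}, |s| < r → |t| < r → nullPt o s t ∈ U := fun hs ht =>
    hsub (nullPt_mem hs ht)
  have cs := contDiffOn_ds hU hl
  have ct := contDiffOn_dt hU hl
  have css := contDiffOn_ds hU cs
  have Ds : ∀ {f : ℝ × ℝ → ℝ}, ContDiffOn ℝ (⊤ : ℕ∞) f U → ∀ {s t : ℝ}, |s| < r → |t| < r →
      HasDerivAt (fun s => f (nullPt o s t)) (ds f (nullPt o s t)) s := fun hf _ _ hs ht =>
    hasDerivAt_ds (differentiableAt_of_contDiffOn hU hf (hmem hs ht))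
  have Dt : ∀ {f : ℝ × ℝ → ℝ}, ContDiffOn ℝ (⊤ : ℕ∞) f U → ∀ {s t : ℝ}, |s| < r → |t| < r →
      HasDerivAt (fun t => f (nullPt o s t)) (dt f (nullPt o s t)) t := fun hf _ _ hs ht =>
    hasDerivAt_dt (differentiableAt_of_contDiffOn hU hf (hmem hs ht))
  have e1 : ∀ {s t}, |s| < r → |t| < r →
      dt (ds l) (nullPt o s t) = k * Real.exp (-2 * l (nullPt o s t)) := fun hs ht =>
    hL _ (nullPt_mem hs ht)
  have e2 : ∀ {s t}, |s| < r → |t| < r →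
      ds (dt l) (nullPt o s t) = k * Real.exp (-2 * l (nullPt o s t)) := fun hs ht => by
    rw [← e1 hs ht, (ds_dt_eq hU hl (hmem hs ht)).1, (ds_dt_eq hU hl (hmem hs ht)).2]
  have dE : ∀ {s t}, |s| < r → |t| < r →
      HasDerivAt (fun s => k * Real.exp (-2 * l (nullPt o s t)))
        (k * (Real.exp (-2 * l (nullPt o s t)) * (-2 * ds l (nullPt o s t)))) s := fun hs ht =>
    (((Ds hl hs ht).const_mul (-2)).exp).const_mul k
  have e3 : ∀ {s t}, |s| < r → |t| < r → dt (ds (ds l)) (nullPt o s t) =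
      k * (Real.exp (-2 * l (nullPt o s t)) * (-2 * ds l (nullPt o s t))) := by
    intro s t hs ht
    rw [(ds_dt_eq hU cs (hmem hs ht)).2, ← (ds_dt_eq hU cs (hmem hs ht)).1]
    exact hasDerivAt_unique_of_abs_lt (Ds (contDiffOn_dt hU cs) hs ht) (dE hs ht)
      (fun s hs => e1 hs ht) hs
  set Q : ℝ → ℝ := fun s => ds (ds l) (nullPt o s 0) + ds l (nullPt o s 0) ^ 2 with hQ
  have eQ : ∀ {s t}, |s| < r → |t| < r →
      ds (ds l) (nullPt o s t) + ds l (nullPt o s t) ^ 2 = Q s := by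
    intro s t hs ht
    refine eq_zero_value_of_hasDerivAt_zero
      (f := fun t => ds (ds l) (nullPt o s t) + ds l (nullPt o s t) ^ 2) ?_ ht
    intro t ht
    refine ((Dt css hs ht).add ((Dt cs hs ht).pow 2)).congr_deriv ?_
    rw [e3 hs ht, e1 hs ht]
    simp
    ring
  have hM : ∀ {s t}, |s| < r → |t| < r → HasDerivAt (fun s => Real.exp (l (nullPt o s t)))
      (Real.exp (l (nullPt o s t)) * ds l (nullPt o s t)) s := fun hs ht => (Ds hl hs ht).exp
  have hM' : ∀ {s t}, |s| < r → |t| < r →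
      HasDerivAt (fun s => Real.exp (l (nullPt o s t)) * ds l (nullPt o s t))
        (Q s * Real.exp (l (nullPt o s t))) s := fun hs ht => by
    refine ((hM hs ht).mul (Ds cs hs ht)).congr_deriv ?_
    rw [← eQ hs ht]
    ring
  have ee : ∀ x : ℝ, Real.exp x * Real.exp (-2 * x) * Real.exp x = 1 := fun x => by
    rw [← Real.exp_add, ← Real.exp_add]; ring_nf; exact Real.exp_zero
  -- `g` is the `t`-derivative of `exp l` along the `s`-axis
  have hg : ∀ s, |s| < r → HasDerivAt (fun s => Real.exp (l (nullPt o s 0)) * dt l (nullPt o s 0))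
      (Real.exp (l (nullPt o s 0)) * (ds l (nullPt o s 0) * dt l (nullPt o s 0) +
        k * Real.exp (-2 * l (nullPt o s 0)))) s := fun s hs => by
    refine ((hM hs h0).mul (Ds ct hs h0)).congr_deriv ?_
    rw [e2 hs h0]
    ring
  have hg' : ∀ s, |s| < r → HasDerivAt (fun s => Real.exp (l (nullPt o s 0)) *
        (ds l (nullPt o s 0) * dt l (nullPt o s 0) + k * Real.exp (-2 * l (nullPt o s 0))))
      (Q s * (Real.exp (l (nullPt o s 0)) * dt l (nullPt o s 0))) s := fun s hs => by
    refine ((hM hs h0).mul (((Ds cs hs h0).mul (Ds ct hs h0)).add (dE hs h0))).congr_deriv ?_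
    rw [e2 hs h0]
    simp only [hQ, Pi.add_apply, Pi.mul_apply]
    ring
  have hW : Real.exp (l (nullPt o 0 0)) * (Real.exp (l (nullPt o 0 0)) *
        (ds l (nullPt o 0 0) * dt l (nullPt o 0 0) + k * Real.exp (-2 * l (nullPt o 0 0)))) -
      Real.exp (l (nullPt o 0 0)) * ds l (nullPt o 0 0) *
        (Real.exp (l (nullPt o 0 0)) * dt l (nullPt o 0 0)) = k := by
    linear_combination k * ee (l (nullPt o 0 0))
  have main := fun {s t : ℝ} (hs : |s| < r) (ht : |t| < r) =>
    eq_combination_of_same_ode (fun s hs => hM hs h0) (fun s hs => hM' hs h0) hg hg'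
      (fun s hs => hM hs ht) (fun s hs => hM' hs ht) hk hW hs
  have cS : ∀ {f : ℝ × ℝ → ℝ}, ContDiffOn ℝ (⊤ : ℕ∞) f U →
      ContDiffOn ℝ (⊤ : ℕ∞) (fun s => f (nullPt o s 0)) (Set.Ioo (-r) r) := fun hf =>
    hf.comp (by unfold nullPt; fun_prop) fun s hs => hmem (abs_lt.2 hs) h0
  have cT : ∀ {f : ℝ × ℝ → ℝ}, ContDiffOn ℝ (⊤ : ℕ∞) f U →
      ContDiffOn ℝ (⊤ : ℕ∞) (fun t => f (nullPt o 0 t)) (Set.Ioo (-r) r) := fun hf =>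
    hf.comp (by unfold nullPt; fun_prop) fun s hs => hmem h0 (abs_lt.2 hs)
  have hz : ∀ {a b t : ℝ}, |t| < r →
      HasDerivAt (fun t => (a * Real.exp (l (nullPt o 0 t)) -
        b * (Real.exp (l (nullPt o 0 t)) * ds l (nullPt o 0 t))) / k)
      ((a * (Real.exp (l (nullPt o 0 t)) * dt l (nullPt o 0 t)) -
        b * (Real.exp (l (nullPt o 0 t)) * dt l (nullPt o 0 t) * ds l (nullPt o 0 t) +
          Real.exp (l (nullPt o 0 t)) * (k * Real.exp (-2 * l (nullPt o 0 t))))) / k) t := by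
    intro a b t ht
    have h1 := (Dt hl h0 ht).exp
    have h2 := h1.mul (Dt cs h0 ht)
    rw [e1 h0 ht] at h2
    exact ((h1.const_mul a).sub (h2.const_mul b)).div_const k
  refine ⟨_, _, _, _, ⟨(cS hl).exp, (cS hl).exp.mul (cS ct),
    ((contDiffOn_const.mul (cT hl).exp).sub
      (contDiffOn_const.mul ((cT hl).exp.mul (cT cs)))).div_const k,
    ((contDiffOn_const.mul (cT hl).exp).sub
      (contDiffOn_const.mul ((cT hl).exp.mul (cT cs)))).div_const k, ?_, ?_,
    fun s t hs ht => (main hs ht).2⟩⟩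
  · intro s hs
    rw [(hg s hs).deriv, (hM hs h0).deriv]
    exact (main hs h0).1
  · intro t ht
    rw [(hz ht).deriv, (hz ht).deriv]
    have e := ee (l (nullPt o 0 t))
    revert hW e
    generalize Real.exp (l (nullPt o 0 0)) * (ds l (nullPt o 0 0) * dt l (nullPt o 0 0) +
      k * Real.exp (-2 * l (nullPt o 0 0))) = g₀'
    generalize Real.exp (l (nullPt o 0 0)) * dt l (nullPt o 0 0) = g₀
    generalize Real.exp (l (nullPt o 0 0)) * ds l (nullPt o 0 0) = f₀'
    generalize Real.exp (l (nullPt o 0 0)) = f₀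
    generalize Real.exp (l (nullPt o 0 t)) = M
    generalize Real.exp (-2 * l (nullPt o 0 t)) = N
    intro hW e
    field_simp
    linear_combination (k * M * N * M) * hW + k ^ 2 * e

theorem hlap_smul_add_smul {U : Set (ℝ × ℝ)} {f g : ℝ × ℝ → ℝ} {p : ℝ × ℝ} (hU : IsOpen U)
    (hf : ContDiffOn ℝ (⊤ : ℕ∞) f U) (hg : ContDiffOn ℝ (⊤ : ℕ∞) g U) (a b : ℝ) (hp : p ∈ U) :
    hlap (fun q => a * f q + b * g q) p = a * hlap f p + b * hlap g p := by
  have key : ∀ {f g h : ℝ × ℝ → ℝ}, ContDiffOn ℝ (⊤ : ℕ∞) f U → ContDiffOn ℝ (⊤ : ℕ∞) g U →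
      (∀ q ∈ U, h q = a * f q + b * g q) → ∀ q ∈ U,
      pu h q = a * pu f q + b * pu g q ∧ pv h q = a * pv f q + b * pv g q := by
    intro f g h hf hg hh q hq
    have e : h =ᶠ[nhds q] fun q => a * f q + b * g q := by
      filter_upwards [hU.mem_nhds hq] with z hz using hh z hz
    have h1 := ((differentiableAt_of_contDiffOn hU hf hq).hasFDerivAt.const_mul a).add
      ((differentiableAt_of_contDiffOn hU hg hq).hasFDerivAt.const_mul b)
    have h2 := (h1.congr_of_eventuallyEq e).fderiv
    simp [pu, pv, h2]
  have k1 := key hf hg (fun _ _ => rfl)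
  have k2 := (key (contDiffOn_pu hU hf) (contDiffOn_pu hU hg) (fun q hq => (k1 q hq).1) p hp).1
  have k3 := (key (contDiffOn_pv hU hf) (contDiffOn_pv hU hg) (fun q hq => (k1 q hq).2) p hp).2
  rw [hlap, k2, k3, hlap, hlap]
  ring

/-- Local existence of a surface with prescribed curvatures. -/
theorem exists_goodSurf_of_natural_equations {D : Set (ℝ × ℝ)} (hD : IsOpen D)
    {K κ : ℝ × ℝ → ℝ} (hK : ContDiffOn ℝ (⊤ : ℕ∞) K D) (hκ : ContDiffOn ℝ (⊤ : ℕ∞) κ D)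
    (hsign : ∀ p ∈ D, K p ^ 2 - κ p ^ 2 > 0)
    (heq1 : ∀ p ∈ D, |K p ^ 2 - κ p ^ 2| ^ ((1 : ℝ) / 4) *
      hlap (fun s => Real.log |K s ^ 2 - κ s ^ 2|) p = -8 * K p)
    (heq2 : ∀ p ∈ D, |K p ^ 2 - κ p ^ 2| ^ ((1 : ℝ) / 4) *
      hlap (fun s => Real.log |(K s + κ s) / (K s - κ s)|) p = -4 * κ p)
    {t₀ : ℝ × ℝ} (ht₀ : t₀ ∈ D) :
    ∃ D₀ : Set (ℝ × ℝ), IsOpen D₀ ∧ t₀ ∈ D₀ ∧ D₀ ⊆ D ∧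
      ∃ x : ℝ × ℝ → V4, GoodSurf D₀ x ∧ ∀ p ∈ D₀, GaussK x p = K p ∧ NormK x p = κ p := by
  have hadd : ∀ p ∈ D, K p + κ p ≠ 0 := fun p hp h => by
    have := hsign p hp; rw [sq_sub_sq, h, zero_mul] at this; exact this.false
  have hsub : ∀ p ∈ D, K p - κ p ≠ 0 := fun p hp h => by
    have := hsign p hp; rw [sq_sub_sq, h, mul_zero] at this; exact this.false
  -- a sign `σ` with `σ K > 0` near `t₀`
  obtain ⟨σ, hσ, hσK⟩ : ∃ σ : ℝ, σ ^ 2 = 1 ∧ 0 < σ * K t₀ := by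
    rcases lt_trichotomy (K t₀) 0 with h | h | h
    · exact ⟨-1, by norm_num, by linarith⟩
    · have := hsign t₀ ht₀
      rw [h] at this
      nlinarith [sq_nonneg (κ t₀)]
    · exact ⟨1, by norm_num, by linarith⟩
  obtain ⟨r, hr, hrU⟩ := exists_nullSq_subset
    ((continuousOn_const.mul hK.continuousOn).isOpen_inter_preimage hD (isOpen_Ioi (a := (0 : ℝ))))
    (show t₀ ∈ D ∩ (fun p => σ * K p) ⁻¹' Set.Ioi 0 from ⟨ht₀, hσK⟩)
  have hrD : nullSq t₀ r ⊆ D := fun p hp => (hrU hp).1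
  set h₁ : ℝ × ℝ → ℝ := fun s => Real.log |K s ^ 2 - κ s ^ 2| with hh₁
  set h₂ : ℝ × ℝ → ℝ := fun s => Real.log |(K s + κ s) / (K s - κ s)| with hh₂
  have c₁ : ContDiffOn ℝ (⊤ : ℕ∞) h₁ D := by
    simp only [hh₁, Real.log_abs]
    exact ((hK.pow 2).sub (hκ.pow 2)).log fun p hp => (hsign p hp).ne'
  have c₂ : ContDiffOn ℝ (⊤ : ℕ∞) h₂ D := by
    simp only [hh₂, Real.log_abs]
    exact ((hK.add hκ).div (hK.sub hκ) hsub).log fun p hp => div_ne_zero (hadd p hp) (hsub p hp)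
  have cl : ∀ b : ℝ, ContDiffOn ℝ (⊤ : ℕ∞) (fun p => (-1 / 8) * h₁ p + b * h₂ p) D := fun b =>
    (contDiffOn_const.mul c₁).add (contDiffOn_const.mul c₂)
  -- the logarithms of `K ± κ`
  have lg : ∀ p ∈ nullSq t₀ r, K p + κ p = σ * Real.exp ((h₁ p + h₂ p) / 2) ∧
      K p - κ p = σ * Real.exp ((h₁ p - h₂ p) / 2) := by
    intro p hp
    have hpD := hrD hp
    have ha := hadd p hpD
    have hs := hsub p hpD
    have pos : 0 < (σ * (K p + κ p)) * (σ * (K p - κ p)) := by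
      have := hsign p hpD
      nlinarith
    have posK : 0 < σ * K p := (hrU hp).2
    have e₁ : h₁ p = Real.log (σ * (K p + κ p)) + Real.log (σ * (K p - κ p)) := by
      rw [← Real.log_mul (left_ne_zero_of_mul pos.ne') (right_ne_zero_of_mul pos.ne')]
      simp only [hh₁, Real.log_abs]
      congr 1
      linear_combination (-(K p ^ 2 - κ p ^ 2)) * hσ
    have hσ0 : σ ≠ 0 := fun h => by simp [h] at hσ
    have e₂ : h₂ p = Real.log (σ * (K p + κ p)) - Real.log (σ * (K p - κ p)) := by
      rw [← Real.log_div (left_ne_zero_of_mul pos.ne') (right_ne_zero_of_mul pos.ne')]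
      simp only [hh₂, Real.log_abs]
      rw [mul_div_mul_left _ _ hσ0]
    have p₁ : 0 < σ * (K p + κ p) := by
      rcases pos_and_pos_or_neg_and_neg_of_mul_pos pos with h | h
      · exact h.1
      · nlinarith [h.1, h.2]
    have p₂ : 0 < σ * (K p - κ p) := pos_of_mul_pos_right pos p₁.le
    have x₁ : (h₁ p + h₂ p) / 2 = Real.log (σ * (K p + κ p)) := by rw [e₁, e₂]; ring
    have x₂ : (h₁ p - h₂ p) / 2 = Real.log (σ * (K p - κ p)) := by rw [e₁, e₂]; ring
    rw [x₁, x₂, Real.exp_log p₁, Real.exp_log p₂]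
    constructor
    · linear_combination (-(K p + κ p)) * hσ
    · linear_combination (-(K p - κ p)) * hσ
  have lap : ∀ p ∈ D, hlap h₁ p = -8 * K p * Real.exp (-h₁ p / 4) ∧
      hlap h₂ p = -4 * κ p * Real.exp (-h₁ p / 4) := by
    intro p hp
    have e : |K p ^ 2 - κ p ^ 2| ^ ((1 : ℝ) / 4) = Real.exp (h₁ p / 4) := by
      rw [Real.rpow_def_of_pos (abs_pos.2 (hsign p hp).ne')]
      congr 1
      ring
    have e' : Real.exp (h₁ p / 4) * Real.exp (-h₁ p / 4) = 1 := by
      rw [← Real.exp_add, Real.exp_eq_one_iff]; ring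
    have q₁ := heq1 p hp
    have q₂ := heq2 p hp
    rw [e] at q₁ q₂
    constructor
    · rw [← q₁]; linear_combination (-hlap h₁ p) * e'
    · rw [← q₂]; linear_combination (-hlap h₂ p) * e'
  have hσ4 : σ / 4 ≠ 0 := fun h => by
    have : σ = 0 := by linarith
    simp [this] at hσ
  have liou : ∀ b : ℝ, b = 1 / 4 ∨ b = -1 / 4 → ∀ p ∈ nullSq t₀ r,
      dt (ds fun p => (-1 / 8) * h₁ p + b * h₂ p) p =
        σ / 4 * Real.exp (-2 * ((-1 / 8) * h₁ p + b * h₂ p)) := by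
    intro b hb p hp
    have hpD := hrD hp
    rw [(ds_dt_eq hD (cl b) hpD).2]
    have := hlap_smul_add_smul hD c₁ c₂ (-1 / 8) b hpD
    rw [hlap] at this
    rw [this, (lap p hpD).1, (lap p hpD).2, smul_eq_mul]
    have hx : ∀ y z : ℝ, -h₁ p / 4 + y = z → Real.exp z = Real.exp (-h₁ p / 4) * Real.exp y :=
      fun y z h => by rw [← h, Real.exp_add]
    rcases hb with rfl | rfl
    · rw [hx ((h₁ p - h₂ p) / 2) (-2 * ((-1 / 8) * h₁ p + 1 / 4 * h₂ p)) (by ring)]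
      linear_combination (Real.exp (-h₁ p / 4) / 4) * (lg p hp).2
    · rw [hx ((h₁ p + h₂ p) / 2) (-2 * ((-1 / 8) * h₁ p + -1 / 4 * h₂ p)) (by ring)]
      linear_combination (Real.exp (-h₁ p / 4) / 4) * (lg p hp).1
  obtain ⟨y₁, y₂, z₁, z₂, hm⟩ :=
    exists_liouvilleFactor hD hr hrD (cl (1 / 4)) hσ4 (liou _ (Or.inl rfl))
  obtain ⟨w₁, w₂, v₁, v₂, hn⟩ :=
    exists_liouvilleFactor hD hr hrD (cl (-1 / 4)) hσ4 (liou _ (Or.inr rfl))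
  obtain ⟨x, hx, hcurv⟩ := exists_goodSurf_of_liouvilleFactor hr
    (by rw [div_pow, hσ]; norm_num) hm hn (fun _ => Real.exp_pos _) (fun _ => Real.exp_pos _)
  refine ⟨nullSq t₀ r, isOpen_nullSq _ _, self_mem_nullSq _ hr, hrD, x, hx, fun p hp => ?_⟩
  obtain ⟨hG, hN⟩ := hcurv p hp
  obtain ⟨l₁, l₂⟩ := lg p hp
  have f₁ : Real.exp ((h₁ p - h₂ p) / 2) * (Real.exp ((-1 / 8) * h₁ p + 1 / 4 * h₂ p) ^ 3 *
      Real.exp ((-1 / 8) * h₁ p + -1 / 4 * h₂ p)) = 1 := by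
    rw [← Real.exp_nat_mul, ← Real.exp_add, ← Real.exp_add, Real.exp_eq_one_iff]
    push_cast; ring
  have f₂ : Real.exp ((h₁ p + h₂ p) / 2) * (Real.exp ((-1 / 8) * h₁ p + -1 / 4 * h₂ p) ^ 3 *
      Real.exp ((-1 / 8) * h₁ p + 1 / 4 * h₂ p)) = 1 := by
    rw [← Real.exp_nat_mul, ← Real.exp_add, ← Real.exp_add, Real.exp_eq_one_iff]
    push_cast; ring
  have m_pos := Real.exp_pos ((-1 / 8) * h₁ p + 1 / 4 * h₂ p)
  have n_pos := Real.exp_pos ((-1 / 8) * h₁ p + -1 / 4 * h₂ p)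
  have eK : K p = σ / 2 * (Real.exp ((h₁ p + h₂ p) / 2) + Real.exp ((h₁ p - h₂ p) / 2)) := by
    linear_combination (l₁ + l₂) / 2
  have eκ : κ p = σ / 2 * (Real.exp ((h₁ p + h₂ p) / 2) - Real.exp ((h₁ p - h₂ p) / 2)) := by
    linear_combination (l₁ - l₂) / 2
  rw [hG, hN, eK, eκ]
  revert f₁ f₂ m_pos n_pos
  generalize Real.exp ((-1 / 8) * h₁ p + 1 / 4 * h₂ p) = m
  generalize Real.exp ((-1 / 8) * h₁ p + -1 / 4 * h₂ p) = n
  generalize Real.exp ((h₁ p + h₂ p) / 2) = a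
  generalize Real.exp ((h₁ p - h₂ p) / 2) = b
  intro f₁ f₂ m_pos n_pos
  constructor
  · rw [div_eq_iff (by positivity)]
    linear_combination (-σ / 2 * n ^ 2) * f₁ - (σ / 2 * m ^ 2) * f₂
  · rw [div_eq_iff (by positivity)]
    linear_combination (σ / 2 * n ^ 2) * f₁ - (σ / 2 * m ^ 2) * f₂

/-- Bonnet-type theorem, second type. Any solution (K, ϰ) of the system of
natural equations with K p ^ 2 - κ p ^ 2 > 0 is locally realized by a unique (up to a proper motion of
ℝ⁴₂) minimal time-like surface of the second type in canonical coordinates. -/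
theorem stmt_15 (D : Set (ℝ × ℝ)) (hD : IsOpen D) (K κ : ℝ × ℝ → ℝ)
    (hK : ContDiffOn ℝ (⊤ : ℕ∞) K D) (hκ : ContDiffOn ℝ (⊤ : ℕ∞) κ D)
    (hsign : ∀ p ∈ D, K p ^ 2 - κ p ^ 2 > 0)
    (heq1 : ∀ p ∈ D, |K p ^ 2 - κ p ^ 2| ^ ((1 : ℝ) / 4) *
      hlap (fun s => Real.log |K s ^ 2 - κ s ^ 2|) p = -8 * K p)
    (heq2 : ∀ p ∈ D, |K p ^ 2 - κ p ^ 2| ^ ((1 : ℝ) / 4) *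
      hlap (fun s => Real.log |(K s + κ s) / (K s - κ s)|) p = -4 * κ p) :
    ∀ t₀ ∈ D,
      (∃ D₀ : Set (ℝ × ℝ), IsOpen D₀ ∧ t₀ ∈ D₀ ∧ D₀ ⊆ D ∧
        ∃ x : ℝ × ℝ → V4, GoodSurf D₀ x ∧
          ∀ p ∈ D₀, GaussK x p = K p ∧ NormK x p = κ p) ∧
      (∀ (D₁ D₂ : Set (ℝ × ℝ)) (x₁ x₂ : ℝ × ℝ → V4),
        IsOpen D₁ → t₀ ∈ D₁ → D₁ ⊆ D → GoodSurf D₁ x₁ →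
        (∀ p ∈ D₁, GaussK x₁ p = K p ∧ NormK x₁ p = κ p) →
        IsOpen D₂ → t₀ ∈ D₂ → D₂ ⊆ D → GoodSurf D₂ x₂ →
        (∀ p ∈ D₂, GaussK x₂ p = K p ∧ NormK x₂ p = κ p) →
        ∃ (D₃ : Set (ℝ × ℝ)) (A : V4 →ₗ[ℝ] V4) (c : V4),
          IsOpen D₃ ∧ t₀ ∈ D₃ ∧ D₃ ⊆ D₁ ∩ D₂ ∧
          (∀ v w : V4, ip (A v) (A w) = ip v w) ∧ LinearMap.det A = 1 ∧
          ∀ p ∈ D₃, x₂ p = A (x₁ p) + c) := by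
  intro t₀ ht₀
  exact ⟨exists_goodSurf_of_natural_equations hD hK hκ hsign heq1 heq2 ht₀,
    fun D₁ D₂ x₁ x₂ hD₁ h₁ _ g₁ k₁ hD₂ h₂ _ g₂ k₂ =>
      exists_motion_of_goodSurf hD₁ h₁ g₁ k₁ hD₂ h₂ g₂ k₂⟩
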